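/- Let (A, φ) be a C*-probability space with faithful tracial φ. Let (X_i)_{i∈ℕ} be free self-adjoint elements of A with φ(X_i) = 0 and φ(X_i²) = σ_i², B_n² := ∑_{i=1}^n σ_i² > 0 for all n, and suppose L_{S,4n} → 0 as n → ∞. Then for all sufficiently large n the self-normalized sum U_n := V_n^{−1/2} S_n V_n^{−1/2} is well-defined in A (where S_n := ∑_{i=1}^n X_i and V_n² := ∑_{i=1}^n X_i²), its analytic distribution μ_n converges weakly to Wigner's semicircle law ω as n → ∞, and moreover ∫ x^k μ_n(dx) → ∫ x^k ω(dx) for every k ∈ ℕ. -/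

import Mathlib

open MeasureTheory Filter Topology

noncomputable section

/-- Wigner's semicircle law: density `(2π)⁻¹ √(4 - t²)` on `[-2, 2]`. -/
def semicircleLaw : Measure ℝ :=
  volume.withDensity fun t =>
    ENNReal.ofReal (Set.indicator (Set.Icc (-2 : ℝ) 2)
      (fun t => (2 * Real.pi)⁻¹ * Real.sqrt (4 - t ^ 2)) t)

/-- Distribution function of a measure on `ℝ`. -/
def cdf (μ : Measure ℝ) (x : ℝ) : ℝ := (μ (Set.Iic x)).toReal

/-- Kolmogorov distance. -/
def kolDist (μ ν : Measure ℝ) : ℝ := ⨆ x : ℝ, |cdf μ x - cdf ν x|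

/-- Cauchy transform. -/
def cauchyG (μ : Measure ℝ) (z : ℂ) : ℂ := ∫ t, (z - (t : ℂ))⁻¹ ∂μ

/-- Support of a measure on `ℝ`. -/
def msupport (μ : Measure ℝ) : Set ℝ :=
  {x : ℝ | ∀ U : Set ℝ, IsOpen U → x ∈ U → 0 < μ U}

variable {A : Type*}

/-- `φ` is a state: unital and positive. -/
def IsState [Ring A] [StarRing A] [Algebra ℂ A] (φ : A →ₗ[ℂ] ℂ) : Prop :=
  φ 1 = 1 ∧ ∀ x : A, 0 ≤ (φ (star x * x)).re ∧ (φ (star x * x)).im = 0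

/-- `φ` is tracial. -/
def IsTracial [Ring A] [Algebra ℂ A] (φ : A →ₗ[ℂ] ℂ) : Prop :=
  ∀ x y : A, φ (x * y) = φ (y * x)

/-- `φ` is faithful. -/
def IsFaithful [Ring A] [StarRing A] [Algebra ℂ A] (φ : A →ₗ[ℂ] ℂ) : Prop :=
  ∀ x : A, φ (star x * x) = 0 → x = 0

/-- Freeness of a family of unital subalgebras w.r.t. `φ`. -/
def IsFreeFamily [Ring A] [Algebra ℂ A] (φ : A →ₗ[ℂ] ℂ)
    {I : Type*} (S : I → Subalgebra ℂ A) : Prop :=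
  ∀ (k : ℕ) (idx : Fin (k + 1) → I),
    (∀ j : Fin k, idx j.castSucc ≠ idx j.succ) →
    ∀ x : Fin (k + 1) → A, (∀ j, x j ∈ S (idx j)) → (∀ j, φ (x j) = 0) →
      φ (List.ofFn x).prod = 0

/-- Freeness of a family of elements: the generated unital subalgebras are free. -/
def AreFree [Ring A] [Algebra ℂ A] (φ : A →ₗ[ℂ] ℂ) {I : Type*} (X : I → A) : Prop :=
  IsFreeFamily φ fun i => Algebra.adjoin ℂ {X i}

/-- `μ` is the analytic distribution of `x`: a probability measure whose moments are the
`φ`-moments of `x`. -/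
def IsDistribution [Ring A] [Algebra ℂ A] (φ : A →ₗ[ℂ] ℂ) (x : A) (μ : Measure ℝ) : Prop :=
  IsProbabilityMeasure μ ∧ ∀ k : ℕ, φ (x ^ k) = ((∫ t, t ^ k ∂μ : ℝ) : ℂ)

/-- The Lyapunov-type fraction `L_{S,kn} = (∑_{i<n} ‖X i‖ ^ k) / B_n ^ k`. -/
def Lsn [Norm A] (X : ℕ → A) (σ : ℕ → ℝ) (k n : ℕ) : ℝ :=
  (∑ i ∈ Finset.range n, ‖X i‖ ^ k) /
    Real.sqrt (∑ i ∈ Finset.range n, σ i ^ 2) ^ k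

/-- `s` is a standard semicircular element. -/
def IsStdSemicircular [Ring A] [StarRing A] [Algebra ℂ A] (φ : A →ₗ[ℂ] ℂ) (s : A) : Prop :=
  IsSelfAdjoint s ∧ ∀ k : ℕ, φ (s ^ k) = ((∫ t, t ^ k ∂semicircleLaw : ℝ) : ℂ)

end

section Hilbert
open scoped InnerProductSpace

variable {H ι : Type*} [NormedAddCommGroup H] [InnerProductSpace ℂ H]

theorem norm_sq_sum_of_mem {K : ι → Submodule ℂ H}
    (hK : OrthogonalFamily ℂ (fun i => K i) fun i => (K i).subtypeₗᵢ) (s : Finset ι)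
    {y : ι → H} (hy : ∀ i, y i ∈ K i) : ‖∑ i ∈ s, y i‖ ^ 2 = ∑ i ∈ s, ‖y i‖ ^ 2 := by
  simpa using hK.norm_sum (fun i => (⟨y i, hy i⟩ : K i)) s

/-- Bessel's inequality for pairwise orthogonal subspaces. -/
theorem sum_norm_sq_starProjection_le (K : ι → Submodule ℂ H)
    [∀ i, (K i).HasOrthogonalProjection]
    (hK : OrthogonalFamily ℂ (fun i => K i) fun i => (K i).subtypeₗᵢ) (s : Finset ι) (x : H) :
    ∑ i ∈ s, ‖(K i).starProjection x‖ ^ 2 ≤ ‖x‖ ^ 2 := by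
  have h1 := norm_sq_sum_of_mem hK s (y := fun i => (K i).starProjection x)
    fun i => Submodule.starProjection_apply_mem _ _
  have h2 : RCLike.re ⟪x, ∑ i ∈ s, (K i).starProjection x⟫_ℂ
      = ∑ i ∈ s, ‖(K i).starProjection x‖ ^ 2 := by
    rw [inner_sum, map_sum]
    refine Finset.sum_congr rfl fun i _ => ?_
    have := Submodule.re_inner_starProjection_eq_normSq (K i) x
    rw [inner_re_symm, this]
    simp
  have h3 : RCLike.re ⟪x, ∑ i ∈ s, (K i).starProjection x⟫_ℂ
      ≤ ‖x‖ * ‖∑ i ∈ s, (K i).starProjection x‖ := re_inner_le_norm _ _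
  nlinarith [sq_nonneg (‖x‖ - ‖∑ i ∈ s, (K i).starProjection x‖)]

theorem norm_sub_starProjection_le (K : Submodule ℂ H) [K.HasOrthogonalProjection] (x : H) :
    ‖x - K.starProjection x‖ ≤ ‖x‖ := by
  rw [← Submodule.starProjection_orthogonal_val]
  exact Submodule.norm_starProjection_apply_le _ _

/-- Symmetric operators `T i` which behave on the invariant subspace `D` like centred free
variables of variance `τ i ^ 2`, where `K i` is the closed span of the words starting with the
letter `i`. -/
structure IsFreeFock (K : ι → Submodule ℂ H) [∀ i, (K i).HasOrthogonalProjection]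
    (D : Submodule ℂ H) (T : ι → H →L[ℂ] H) (τ : ι → ℝ) : Prop where
  orth : OrthogonalFamily ℂ (fun i => K i) fun i => (K i).subtypeₗᵢ
  le : ∀ i, K i ≤ D
  symm : ∀ i x y, ⟪T i x, y⟫_ℂ = ⟪x, T i y⟫_ℂ
  maps : ∀ i, ∀ x ∈ D, T i x ∈ D
  creates : ∀ i, ∀ x ∈ D, T i (x - (K i).starProjection x) ∈ K i
  sq : ∀ i, ∀ x ∈ D, T i (T i (x - (K i).starProjection x)) -
    ((τ i ^ 2 : ℝ) : ℂ) • (x - (K i).starProjection x) ∈ K i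

namespace IsFreeFock

variable {K : ι → Submodule ℂ H} [∀ i, (K i).HasOrthogonalProjection]
  {D : Submodule ℂ H} {T : ι → H →L[ℂ] H} {τ : ι → ℝ}

theorem norm_sq_creation (h : IsFreeFock K D T τ) (i : ι) {x : H} (hx : x ∈ D) :
    ‖T i (x - (K i).starProjection x)‖ ^ 2 = τ i ^ 2 * ‖x - (K i).starProjection x‖ ^ 2 := by
  set y := x - (K i).starProjection x with hy
  have hyo : y ∈ (K i)ᗮ := Submodule.sub_starProjection_mem_orthogonal x
  have h0 : ⟪y, T i (T i y) - ((τ i ^ 2 : ℝ) : ℂ) • y⟫_ℂ = 0 :=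
    Submodule.inner_left_of_mem_orthogonal (h.sq i x hx) hyo
  rw [inner_sub_right, inner_smul_right, ← h.symm, inner_self_eq_norm_sq_to_K,
    inner_self_eq_norm_sq_to_K, sub_eq_zero] at h0
  exact Complex.ofReal_injective (by simpa using h0)

theorem norm_sq_sum_creation_le (h : IsFreeFock K D T τ) (s : Finset ι) {x : H} (hx : x ∈ D) :
    ‖∑ i ∈ s, T i (x - (K i).starProjection x)‖ ^ 2 ≤ (∑ i ∈ s, τ i ^ 2) * ‖x‖ ^ 2 := by
  rw [norm_sq_sum_of_mem h.orth s fun i => h.creates i x hx, Finset.sum_mul]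
  refine Finset.sum_le_sum fun i _ => ?_
  rw [h.norm_sq_creation i hx]
  gcongr
  exact norm_sub_starProjection_le _ _

/-- The part of `T i P i x` outside `K i`, bounded by duality with the creation part. -/
theorem norm_sum_annihilation_le (h : IsFreeFock K D T τ) (s : Finset ι) (x : H) :
    ‖∑ i ∈ s, (T i ((K i).starProjection x) -
      (K i).starProjection (T i ((K i).starProjection x)))‖ ≤ √(∑ i ∈ s, τ i ^ 2) * ‖x‖ := by
  set z := ∑ i ∈ s, (T i ((K i).starProjection x) -
      (K i).starProjection (T i ((K i).starProjection x))) with hz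
  have hPD : ∀ i y, (K i).starProjection y ∈ D := fun i y =>
    h.le i (Submodule.starProjection_apply_mem _ _)
  have hzD : z ∈ D := Submodule.sum_mem _ fun i _ =>
    Submodule.sub_mem _ (h.maps i _ (hPD i x)) (hPD i _)
  have key : ∀ i, ⟪T i ((K i).starProjection x) -
      (K i).starProjection (T i ((K i).starProjection x)), z⟫_ℂ
      = ⟪(K i).starProjection x, T i (z - (K i).starProjection z)⟫_ℂ := by
    intro i
    rw [← h.symm, inner_sub_left, inner_sub_right, Submodule.inner_starProjection_left_eq_right]
  have h1 : ‖z‖ ^ 2 ≤ ∑ i ∈ s, ‖(K i).starProjection x‖ *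
      ‖T i (z - (K i).starProjection z)‖ := by
    have : ((‖z‖ ^ 2 : ℝ) : ℂ) = ∑ i ∈ s, ⟪(K i).starProjection x,
        T i (z - (K i).starProjection z)⟫_ℂ := by
      rw [← Finset.sum_congr rfl fun i _ => key i, ← sum_inner, ← hz, inner_self_eq_norm_sq_to_K]
      simp
    calc ‖z‖ ^ 2 = ‖((‖z‖ ^ 2 : ℝ) : ℂ)‖ := by simp
      _ ≤ ∑ i ∈ s, ‖⟪(K i).starProjection x, T i (z - (K i).starProjection z)⟫_ℂ‖ := by
        rw [this]; exact norm_sum_le _ _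
      _ ≤ _ := Finset.sum_le_sum fun i _ => norm_inner_le_norm _ _
  have h2 := Finset.sum_mul_sq_le_sq_mul_sq s (fun i => ‖(K i).starProjection x‖)
    fun i => ‖T i (z - (K i).starProjection z)‖
  have h3 := sum_norm_sq_starProjection_le K h.orth s x
  have h4 : ∑ i ∈ s, ‖T i (z - (K i).starProjection z)‖ ^ 2 ≤ (∑ i ∈ s, τ i ^ 2) * ‖z‖ ^ 2 := by
    rw [← norm_sq_sum_of_mem h.orth s fun i => h.creates i z hzD]
    exact h.norm_sq_sum_creation_le s hzD
  have hτ : 0 ≤ ∑ i ∈ s, τ i ^ 2 := Finset.sum_nonneg fun i _ => sq_nonneg _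
  have h5 : (‖z‖ ^ 2) ^ 2 ≤ ‖x‖ ^ 2 * ((∑ i ∈ s, τ i ^ 2) * ‖z‖ ^ 2) :=
    (pow_le_pow_left₀ (by positivity) h1 2).trans (h2.trans
      (mul_le_mul h3 h4 (Finset.sum_nonneg fun i _ => sq_nonneg _) (by positivity)))
  refine abs_le_of_sq_le_sq' ?_ (by positivity) |>.2
  rw [mul_pow, Real.sq_sqrt hτ]
  rcases eq_or_ne ‖z‖ 0 with h0 | h0
  · rw [h0, zero_pow two_ne_zero]; positivity
  · have : 0 < ‖z‖ ^ 2 := by positivity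
    nlinarith

/-- Voiculescu's inequality on the invariant subspace. -/
theorem norm_sum_apply_le (h : IsFreeFock K D T τ) (s : Finset ι) {M : ℝ} (hM0 : 0 ≤ M)
    (hM : ∀ i ∈ s, ‖T i‖ ≤ M) {x : H} (hx : x ∈ D) :
    ‖∑ i ∈ s, T i x‖ ≤ (M + 2 * √(∑ i ∈ s, τ i ^ 2)) * ‖x‖ := by
  have hτ : 0 ≤ ∑ i ∈ s, τ i ^ 2 := Finset.sum_nonneg fun i _ => sq_nonneg _
  have hdec : ∑ i ∈ s, T i x = ∑ i ∈ s, T i (x - (K i).starProjection x) +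
      ∑ i ∈ s, (K i).starProjection (T i ((K i).starProjection x)) +
      ∑ i ∈ s, (T i ((K i).starProjection x) -
      (K i).starProjection (T i ((K i).starProjection x))) := by
    rw [← Finset.sum_add_distrib, ← Finset.sum_add_distrib]
    refine Finset.sum_congr rfl fun i _ => ?_
    rw [map_sub]; abel
  have h1 : ‖∑ i ∈ s, T i (x - (K i).starProjection x)‖ ≤ √(∑ i ∈ s, τ i ^ 2) * ‖x‖ := by
    refine abs_le_of_sq_le_sq' ?_ (by positivity) |>.2
    rw [mul_pow, Real.sq_sqrt hτ]
    exact h.norm_sq_sum_creation_le s hx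
  have h2 : ‖∑ i ∈ s, (K i).starProjection (T i ((K i).starProjection x))‖ ≤ M * ‖x‖ := by
    refine abs_le_of_sq_le_sq' ?_ (by positivity) |>.2
    rw [norm_sq_sum_of_mem h.orth s fun i => Submodule.starProjection_apply_mem _ _, mul_pow]
    calc _ ≤ ∑ i ∈ s, M ^ 2 * ‖(K i).starProjection x‖ ^ 2 := by
          refine Finset.sum_le_sum fun i hi => ?_
          rw [← mul_pow]
          gcongr
          refine (Submodule.norm_starProjection_apply_le _ _).trans ?_
          exact (T i).le_of_opNorm_le (hM i hi) _
      _ ≤ _ := by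
          rw [← Finset.mul_sum]
          gcongr
          exact sum_norm_sq_starProjection_le K h.orth s x
  have h3 := h.norm_sum_annihilation_le s x
  rw [hdec]
  refine (norm_add₃_le).trans ?_
  linarith

/-- Iterated creation: the sums over all alternating words of length `k`. -/
noncomputable def creationVec (K : ι → Submodule ℂ H) [∀ i, (K i).HasOrthogonalProjection]
    (T : ι → H →L[ℂ] H) (s : Finset ι) (Ω : H) : ℕ → H
  | 0 => Ω
  | k + 1 => ∑ i ∈ s, T i (creationVec K T s Ω k - (K i).starProjection (creationVec K T s Ω k))

theorem creationVec_mem (h : IsFreeFock K D T τ) (s : Finset ι) {Ω : H} (hΩ : Ω ∈ D) (k : ℕ) :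
    creationVec K T s Ω k ∈ D := by
  induction k with
  | zero => exact hΩ
  | succ k ih => exact Submodule.sum_mem _ fun i _ => h.le i (h.creates i _ ih)

theorem norm_creationVec_le (h : IsFreeFock K D T τ) (s : Finset ι) {Ω : H} (hΩ : Ω ∈ D)
    (hn : ‖Ω‖ = 1) (hτ : ∑ i ∈ s, τ i ^ 2 = 1) (k : ℕ) : ‖creationVec K T s Ω k‖ ≤ 1 := by
  induction k with
  | zero => exact hn.le
  | succ k ih =>
    have := h.norm_sq_sum_creation_le s (h.creationVec_mem s hΩ k)
    rw [hτ, one_mul] at this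
    exact (abs_le_of_sq_le_sq' this (norm_nonneg _)).2.trans ih

theorem starProjection_creationVec_succ (h : IsFreeFock K D T τ) (s : Finset ι) {Ω : H}
    (hΩ : Ω ∈ D) (k : ℕ) {i : ι} (hi : i ∈ s) :
    (K i).starProjection (creationVec K T s Ω (k + 1)) =
      T i (creationVec K T s Ω k - (K i).starProjection (creationVec K T s Ω k)) := by
  classical
  have hm := h.creationVec_mem s hΩ k
  rw [creationVec, map_sum, Finset.sum_eq_single_of_mem i hi]
  · exact Submodule.starProjection_eq_self_iff.2 (h.creates i _ hm)
  · intro j _ hj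
    rw [Submodule.starProjection_apply_eq_zero_iff]
    exact (h.orth.isOrtho hj) (h.creates j _ hm)

theorem norm_sum_sub_creationVec_le (h : IsFreeFock K D T τ) (s : Finset ι) {Ω : H} (hΩ : Ω ∈ D)
    (hn : ‖Ω‖ = 1) (hτ : ∑ i ∈ s, τ i ^ 2 = 1) {ε : ι → ℝ} (hε : ∀ i ∈ s, ‖T i‖ ≤ ε i)
    (hτε : ∀ i ∈ s, τ i ^ 2 ≤ ε i ^ 2) (k : ℕ) :
    ‖∑ i ∈ s, T i (creationVec K T s Ω (k + 1)) -
      (creationVec K T s Ω (k + 2) + creationVec K T s Ω k)‖ ≤ 3 * √(∑ i ∈ s, ε i ^ 4) := by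
  set e := creationVec K T s Ω with he
  have hm := h.creationVec_mem s hΩ k
  have hk := h.norm_creationVec_le s hΩ hn hτ k
  rw [← he] at hm hk
  have hδ : 0 ≤ ∑ i ∈ s, ε i ^ 4 := Finset.sum_nonneg fun i _ => by positivity
  have hdec : ∑ i ∈ s, T i (e (k + 1)) - (e (k + 2) + e k) =
      ∑ i ∈ s, (T i (T i (e k - (K i).starProjection (e k))) -
        ((τ i ^ 2 : ℝ) : ℂ) • (e k - (K i).starProjection (e k))) -
      ∑ i ∈ s, ((τ i ^ 2 : ℝ) : ℂ) • (K i).starProjection (e k) := by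
    have h1 : ∑ i ∈ s, T i (e (k + 1)) = e (k + 2) +
        ∑ i ∈ s, T i (T i (e k - (K i).starProjection (e k))) := by
      have h2 : e (k + 2) = ∑ i ∈ s, T i (e (k + 1) - (K i).starProjection (e (k + 1))) := rfl
      rw [h2, ← Finset.sum_add_distrib]
      refine Finset.sum_congr rfl fun i hi => ?_
      rw [h.starProjection_creationVec_succ s hΩ k hi, map_sub, sub_add_cancel]
    have h2 : e k = ∑ i ∈ s, ((τ i ^ 2 : ℝ) : ℂ) • e k := by
      rw [← Finset.sum_smul, ← Complex.ofReal_sum, hτ]; simp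
    have h3 : ∑ i ∈ s, T i (T i (e k - (K i).starProjection (e k))) - e k =
        ∑ i ∈ s, T i (T i (e k - (K i).starProjection (e k))) -
          ∑ i ∈ s, ((τ i ^ 2 : ℝ) : ℂ) • e k := by rw [← h2]
    rw [h1, add_sub_add_left_eq_sub, h3]
    rw [← Finset.sum_sub_distrib, ← Finset.sum_sub_distrib]
    refine Finset.sum_congr rfl fun i _ => ?_
    rw [smul_sub]; abel
  have b1 : ‖∑ i ∈ s, (T i (T i (e k - (K i).starProjection (e k))) -
        ((τ i ^ 2 : ℝ) : ℂ) • (e k - (K i).starProjection (e k)))‖ ≤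
        2 * √(∑ i ∈ s, ε i ^ 4) := by
    refine abs_le_of_sq_le_sq' ?_ (by positivity) |>.2
    rw [mul_pow, Real.sq_sqrt hδ, norm_sq_sum_of_mem h.orth s fun i => h.sq i _ hm,
      Finset.mul_sum]
    refine Finset.sum_le_sum fun i hi => ?_
    set y := e k - (K i).starProjection (e k)
    have hy : ‖y‖ ≤ 1 := (norm_sub_starProjection_le _ _).trans hk
    have hε0 : 0 ≤ ε i := (norm_nonneg _).trans (hε i hi)
    have a1 : ‖T i (T i y)‖ ≤ ε i ^ 2 := by
      calc _ ≤ ε i * ‖T i y‖ := (T i).le_of_opNorm_le (hε i hi) _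
        _ ≤ ε i * (ε i * ‖y‖) := by gcongr; exact (T i).le_of_opNorm_le (hε i hi) _
        _ ≤ ε i * (ε i * 1) := by gcongr
        _ = _ := by ring
    have a2 : ‖((τ i ^ 2 : ℝ) : ℂ) • y‖ ≤ ε i ^ 2 := by
      rw [norm_smul, Complex.norm_real, Real.norm_of_nonneg (sq_nonneg _)]
      calc _ ≤ ε i ^ 2 * 1 := mul_le_mul (hτε i hi) hy (norm_nonneg _) (sq_nonneg _)
        _ = _ := mul_one _
    have a3 : ‖T i (T i y) - ((τ i ^ 2 : ℝ) : ℂ) • y‖ ≤ 2 * ε i ^ 2 :=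
      (norm_sub_le _ _).trans (by linarith)
    calc _ ≤ (2 * ε i ^ 2) ^ 2 := by gcongr
      _ = _ := by ring
  have b2 : ‖∑ i ∈ s, ((τ i ^ 2 : ℝ) : ℂ) • (K i).starProjection (e k)‖ ≤
        √(∑ i ∈ s, ε i ^ 4) := by
    refine abs_le_of_sq_le_sq' ?_ (by positivity) |>.2
    rw [Real.sq_sqrt hδ, norm_sq_sum_of_mem h.orth s fun i =>
      Submodule.smul_mem _ _ (Submodule.starProjection_apply_mem _ _)]
    refine Finset.sum_le_sum fun i hi => ?_
    have hy : ‖(K i).starProjection (e k)‖ ≤ 1 :=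
      (Submodule.norm_starProjection_apply_le _ _).trans hk
    have a2 : ‖((τ i ^ 2 : ℝ) : ℂ) • (K i).starProjection (e k)‖ ≤ ε i ^ 2 := by
      rw [norm_smul, Complex.norm_real, Real.norm_of_nonneg (sq_nonneg _)]
      calc _ ≤ ε i ^ 2 * 1 := mul_le_mul (hτε i hi) hy (norm_nonneg _) (sq_nonneg _)
        _ = _ := mul_one _
    calc _ ≤ (ε i ^ 2) ^ 2 := by gcongr
      _ = _ := by ring
  rw [hdec]
  exact (norm_sub_le _ _).trans (by linarith)

/-- The Chebyshev recursion applied to `∑ T i` follows the iterated creation vectors. -/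
theorem norm_sub_creationVec_le (h : IsFreeFock K D T τ) (s : Finset ι) {Ω : H} (hΩ : Ω ∈ D)
    (hn : ‖Ω‖ = 1) (hΩK : ∀ i, (K i).starProjection Ω = 0) (hτ : ∑ i ∈ s, τ i ^ 2 = 1)
    {ε : ι → ℝ} (hε : ∀ i ∈ s, ‖T i‖ ≤ ε i) (hτε : ∀ i ∈ s, τ i ^ 2 ≤ ε i ^ 2)
    (hS : ∀ x ∈ D, ‖∑ i ∈ s, T i x‖ ≤ 3 * ‖x‖)
    {u : ℕ → H} (u0 : u 0 = Ω) (u1 : u 1 = ∑ i ∈ s, T i Ω)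
    (u2 : ∀ k, u (k + 2) = ∑ i ∈ s, T i (u (k + 1)) - u k) (k : ℕ) :
    ‖u k - creationVec K T s Ω k‖ ≤ 4 ^ k * √(∑ i ∈ s, ε i ^ 4) := by
  have hu : ∀ k, u k ∈ D ∧ u (k + 1) ∈ D := by
    intro k
    induction k with
    | zero => exact ⟨u0 ▸ hΩ, u1 ▸ Submodule.sum_mem _ fun i _ => h.maps i _ hΩ⟩
    | succ k ih =>
      refine ⟨ih.2, u2 k ▸ Submodule.sub_mem _ (Submodule.sum_mem _ fun i _ => h.maps i _ ih.2) ih.1⟩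
  suffices ∀ k, ‖u k - creationVec K T s Ω k‖ ≤ 4 ^ k * √(∑ i ∈ s, ε i ^ 4) ∧
      ‖u (k + 1) - creationVec K T s Ω (k + 1)‖ ≤ 4 ^ (k + 1) * √(∑ i ∈ s, ε i ^ 4) from
    (this k).1
  intro k
  induction k with
  | zero =>
    constructor
    · rw [u0, creationVec, sub_self, norm_zero]; positivity
    · have : u 1 = creationVec K T s Ω 1 := by
        rw [u1, creationVec, creationVec]
        simp [hΩK]
      rw [zero_add, this, sub_self, norm_zero]; positivity
  | succ k ih =>
    refine ⟨ih.2, ?_⟩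
    set e := creationVec K T s Ω with he
    have hd : u (k + 2) - e (k + 2) = ∑ i ∈ s, T i (u (k + 1) - e (k + 1)) - (u k - e k) +
        (∑ i ∈ s, T i (e (k + 1)) - (e (k + 2) + e k)) := by
      rw [u2]; simp only [map_sub, Finset.sum_sub_distrib]; abel
    have b1 := hS (u (k + 1) - e (k + 1))
      (Submodule.sub_mem _ (hu k).2 (h.creationVec_mem s hΩ _))
    have b2 := h.norm_sum_sub_creationVec_le s hΩ hn hτ hε hτε k
    rw [← he] at b2
    have b3 : ‖u (k + 2) - e (k + 2)‖ ≤ ‖∑ i ∈ s, T i (u (k + 1) - e (k + 1))‖ + ‖u k - e k‖ +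
        ‖∑ i ∈ s, T i (e (k + 1)) - (e (k + 2) + e k)‖ := by
      rw [hd]
      exact (norm_add_le _ _).trans (by gcongr; exact norm_sub_le _ _)
    have hp : (1 : ℝ) ≤ 4 ^ k := one_le_pow₀ (by norm_num)
    have hs := Real.sqrt_nonneg (∑ i ∈ s, ε i ^ 4)
    obtain ⟨i1, i2⟩ := ih
    rw [pow_succ] at i2
    show ‖u (k + 2) - e (k + 2)‖ ≤ 4 ^ (k + 1 + 1) * _
    rw [pow_succ, pow_succ]
    nlinarith [mul_le_mul_of_nonneg_right hp hs]

theorem norm_inner_chebyshev_le (h : IsFreeFock K D T τ) (s : Finset ι) {Ω : H} (hΩ : Ω ∈ D)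
    (hn : ‖Ω‖ = 1) (hΩK : ∀ i, (K i).starProjection Ω = 0) (hτ : ∑ i ∈ s, τ i ^ 2 = 1)
    {ε : ι → ℝ} (hε : ∀ i ∈ s, ‖T i‖ ≤ ε i) (hτε : ∀ i ∈ s, τ i ^ 2 ≤ ε i ^ 2)
    (hS : ∀ x ∈ D, ‖∑ i ∈ s, T i x‖ ≤ 3 * ‖x‖)
    {u : ℕ → H} (u0 : u 0 = Ω) (u1 : u 1 = ∑ i ∈ s, T i Ω)
    (u2 : ∀ k, u (k + 2) = ∑ i ∈ s, T i (u (k + 1)) - u k) (k : ℕ) :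
    ‖⟪Ω, u (k + 1)⟫_ℂ‖ ≤ 4 ^ (k + 1) * √(∑ i ∈ s, ε i ^ 4) := by
  have h0 : ⟪Ω, creationVec K T s Ω (k + 1)⟫_ℂ = 0 := by
    rw [creationVec, inner_sum]
    refine Finset.sum_eq_zero fun i _ => ?_
    refine Submodule.inner_left_of_mem_orthogonal (h.creates i _ (h.creationVec_mem s hΩ k)) ?_
    exact (Submodule.starProjection_apply_eq_zero_iff _).1 (hΩK i)
  have : ⟪Ω, u (k + 1)⟫_ℂ = ⟪Ω, u (k + 1) - creationVec K T s Ω (k + 1)⟫_ℂ := by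
    rw [inner_sub_right, h0, sub_zero]
  rw [this]
  refine (norm_inner_le_norm _ _).trans ?_
  rw [hn, one_mul]
  exact h.norm_sub_creationVec_le s hΩ hn hΩK hτ hε hτε hS u0 u1 u2 _

end IsFreeFock
end Hilbert

section Words
open scoped InnerProductSpace ComplexOrder

theorem star_prod_map_snd {M I : Type*} [Monoid M] [StarMul M] (l : List (I × M)) :
    star (l.map Prod.snd).prod =
    ((l.map fun p => (p.1, star p.2)).reverse.map Prod.snd).prod := by
  induction l with
  | nil => simp
  | cons a l ih => simp [ih, List.prod_append]

variable {A ι : Type*} [CStarAlgebra A] [PartialOrder A]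

section

variable (f : A →ₚ[ℂ] ℂ) (S : ι → Subalgebra ℂ A)

/-- Alternating words in centred letters. -/
def IsAltWord (l : List (ι × A)) : Prop :=
  l.IsChain (fun a b => a.1 ≠ b.1) ∧ ∀ a ∈ l, a.2 ∈ S a.1 ∧ f a.2 = 0

variable {f S}

theorem IsAltWord.nil : IsAltWord f S [] := ⟨List.isChain_nil, by simp⟩

theorem IsAltWord.tail {a : ι × A} {l : List (ι × A)} (h : IsAltWord f S (a :: l)) :
    IsAltWord f S l :=
  ⟨h.1.tail, fun b hb => h.2 b (List.mem_cons_of_mem _ hb)⟩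

theorem IsAltWord.cons {i : ι} {a : A} {l : List (ι × A)} (ha : a ∈ S i) (ha0 : f a = 0)
    (h : IsAltWord f S l) (hl : ∀ b ∈ l.head?, i ≠ b.1) : IsAltWord f S ((i, a) :: l) := by
  refine ⟨List.isChain_cons.2 ⟨hl, h.1⟩, ?_⟩
  intro b hb
  rcases List.mem_cons.1 hb with rfl | hb
  · exact ⟨ha, ha0⟩
  · exact h.2 b hb

theorem IsAltWord.map_prod_eq_zero (hfree : IsFreeFamily f.toLinearMap S) {l : List (ι × A)}
    (h : IsAltWord f S l) (hl : l ≠ []) : f (l.map Prod.snd).prod = 0 := by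
  obtain ⟨k, hk⟩ : ∃ k, l.length = k + 1 :=
    Nat.exists_eq_succ_of_ne_zero (by simpa using hl)
  have := hfree k (fun j => (l[(j : ℕ)]'(by omega)).1) (fun j => ?_)
    (fun j => (l[(j : ℕ)]'(by omega)).2) (fun j => (h.2 _ (List.getElem_mem _)).1)
    (fun j => (h.2 _ (List.getElem_mem _)).2)
  · refine (congrArg (fun l : List A => f l.prod) ?_).trans this
    refine List.ext_getElem (by simp [hk]) fun i _ _ => ?_
    rw [List.getElem_ofFn, List.getElem_map]
  · exact List.isChain_iff_getElem.1 h.1 j (by omega)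

end

variable [StarOrderedRing A]

/-- The cyclic vector of the GNS representation. -/
noncomputable def gnsVacuum (f : A →ₚ[ℂ] ℂ) : f.GNS := ((f.toPreGNS 1 : f.PreGNS) : f.GNS)

theorem inner_gnsVacuum (f : A →ₚ[ℂ] ℂ) (a : A) :
    ⟪gnsVacuum f, f.gnsStarAlgHom a (gnsVacuum f)⟫_ℂ = f a := by
  simp [gnsVacuum, PositiveLinearMap.preGNS_inner_def]

theorem inner_gns_apply (f : A →ₚ[ℂ] ℂ) (a : A) (x y : f.GNS) :
    ⟪f.gnsStarAlgHom a x, y⟫_ℂ = ⟪x, f.gnsStarAlgHom (star a) y⟫_ℂ := by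
  rw [map_star, ContinuousLinearMap.star_eq_adjoint, ContinuousLinearMap.adjoint_inner_right]

theorem gns_mul_apply (f : A →ₚ[ℂ] ℂ) (a b : A) (x : f.GNS) :
    f.gnsStarAlgHom (a * b) x = f.gnsStarAlgHom a (f.gnsStarAlgHom b x) := by
  rw [map_mul]; rfl

theorem gns_one_apply (f : A →ₚ[ℂ] ℂ) (x : f.GNS) : f.gnsStarAlgHom 1 x = x := by
  rw [map_one]; rfl

theorem gns_add_apply (f : A →ₚ[ℂ] ℂ) (a b : A) (x : f.GNS) :
    f.gnsStarAlgHom (a + b) x = f.gnsStarAlgHom a x + f.gnsStarAlgHom b x := by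
  rw [map_add]; rfl

theorem gns_sub_apply (f : A →ₚ[ℂ] ℂ) (a b : A) (x : f.GNS) :
    f.gnsStarAlgHom (a - b) x = f.gnsStarAlgHom a x - f.gnsStarAlgHom b x := by
  rw [map_sub]; rfl

theorem gns_smul_apply (f : A →ₚ[ℂ] ℂ) (c : ℂ) (a : A) (x : f.GNS) :
    f.gnsStarAlgHom (c • a) x = c • f.gnsStarAlgHom a x := by
  rw [map_smul]; rfl

theorem inner_gns_vacuum_vacuum (f : A →ₚ[ℂ] ℂ) (a b : A) :
    ⟪f.gnsStarAlgHom a (gnsVacuum f), f.gnsStarAlgHom b (gnsVacuum f)⟫_ℂ = f (star a * b) := by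
  rw [inner_gns_apply, ← gns_mul_apply, inner_gnsVacuum]

variable (f : A →ₚ[ℂ] ℂ) (S : ι → Subalgebra ℂ A)

/-- The vector of the GNS space given by a word. -/
noncomputable def wordVec (l : List (ι × A)) : f.GNS :=
  f.gnsStarAlgHom (l.map Prod.snd).prod (gnsVacuum f)

/-- Closed span of the alternating words starting with the letter `i`. -/
noncomputable def wordSpaceAt (i : ι) : Submodule ℂ f.GNS :=
  (Submodule.span ℂ {x | ∃ a l, IsAltWord f S ((i, a) :: l) ∧
    wordVec f ((i, a) :: l) = x}).topologicalClosure

/-- Closed span of all alternating words. -/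
noncomputable def wordSpace : Submodule ℂ f.GNS :=
  (Submodule.span ℂ {x | ∃ l, IsAltWord f S l ∧ wordVec f l = x}).topologicalClosure

noncomputable instance (i : ι) : CompleteSpace (wordSpaceAt f S i) :=
  Submodule.topologicalClosure.completeSpace _

theorem wordSpaceAt_le (i : ι) : wordSpaceAt f S i ≤ wordSpace f S := by
  refine Submodule.topologicalClosure_mono (Submodule.span_mono ?_)
  rintro _ ⟨a, l, h, rfl⟩
  exact ⟨_, h, rfl⟩

variable {f S}

theorem wordVec_mem {l : List (ι × A)} (h : IsAltWord f S l) : wordVec f l ∈ wordSpace f S :=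
  Submodule.le_topologicalClosure _ (Submodule.subset_span ⟨l, h, rfl⟩)

theorem wordVec_cons_mem {i : ι} {a : A} {l : List (ι × A)} (h : IsAltWord f S ((i, a) :: l)) :
    wordVec f ((i, a) :: l) ∈ wordSpaceAt f S i :=
  Submodule.le_topologicalClosure _ (Submodule.subset_span ⟨a, l, h, rfl⟩)

theorem wordSpace_le {p : Submodule ℂ f.GNS} (hp : IsClosed (p : Set f.GNS))
    (h : ∀ l, IsAltWord f S l → wordVec f l ∈ p) : wordSpace f S ≤ p := by
  refine Submodule.topologicalClosure_minimal _ (Submodule.span_le.2 ?_) hp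
  rintro _ ⟨l, hl, rfl⟩
  exact h l hl

theorem gns_wordVec (a : A) (i : ι) (l : List (ι × A)) :
    f.gnsStarAlgHom a (wordVec f l) = wordVec f ((i, a) :: l) := by
  simp only [wordVec, List.map_cons, List.prod_cons, gns_mul_apply]

theorem inner_wordVec_eq_zero (hfree : IsFreeFamily f.toLinearMap S)
    (hstar : ∀ i, ∀ x ∈ S i, star x ∈ S i) {l l' : List (ι × A)} (h : IsAltWord f S l)
    (h' : IsAltWord f S l') (hne : l ≠ [] ∨ l' ≠ [])
    (hd : ∀ a ∈ l.head?, ∀ b ∈ l'.head?, a.1 ≠ b.1) : ⟪wordVec f l, wordVec f l'⟫_ℂ = 0 := by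
  rw [wordVec, wordVec, inner_gns_vacuum_vacuum]
  have hprod : star (l.map Prod.snd).prod * (l'.map Prod.snd).prod =
      (((l.map fun p => (p.1, star p.2)).reverse ++ l').map Prod.snd).prod := by
    rw [List.map_append, List.prod_append, star_prod_map_snd]
  rw [hprod]
  refine IsAltWord.map_prod_eq_zero hfree ⟨?_, ?_⟩ ?_
  · rw [List.isChain_append, List.isChain_reverse, List.isChain_map]
    refine ⟨h.1.imp fun _ _ hab => hab.symm, h'.1, ?_⟩
    intro x hx y hy
    rw [List.getLast?_reverse, List.head?_map] at hx
    simp only [Option.mem_def, Option.map_eq_some_iff] at hx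
    obtain ⟨a, ha, rfl⟩ := hx
    exact hd a ha y hy
  · intro a ha
    rcases List.mem_append.1 ha with ha | ha
    · obtain ⟨b, hb, rfl⟩ := List.mem_map.1 (List.mem_reverse.1 ha)
      refine ⟨hstar _ _ (h.2 b hb).1, ?_⟩
      show f (star b.2) = 0
      rw [map_star, (h.2 b hb).2, star_zero]
    · exact h'.2 a ha
  · simpa [← not_and_or] using hne

theorem isOrtho_wordSpaceAt (hfree : IsFreeFamily f.toLinearMap S)
    (hstar : ∀ i, ∀ x ∈ S i, star x ∈ S i) {i : ι} {l : List (ι × A)} (h : IsAltWord f S l)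
    (hl : ∀ b ∈ l.head?, i ≠ b.1) : wordVec f l ∈ (wordSpaceAt f S i)ᗮ := by
  rw [wordSpaceAt, Submodule.orthogonal_closure, Submodule.mem_orthogonal]
  intro u hu
  induction hu using Submodule.span_induction with
  | mem x hx =>
    obtain ⟨a, l', h', rfl⟩ := hx
    refine inner_wordVec_eq_zero hfree hstar h' h (by simp) ?_
    simpa using hl
  | zero => simp
  | add x y _ _ hx hy => rw [inner_add_left, hx, hy, add_zero]
  | smul c x _ hx => rw [inner_smul_left, hx, mul_zero]

theorem orthogonalFamily_wordSpaceAt (hfree : IsFreeFamily f.toLinearMap S)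
    (hstar : ∀ i, ∀ x ∈ S i, star x ∈ S i) :
    OrthogonalFamily ℂ (fun i => wordSpaceAt f S i) fun i => (wordSpaceAt f S i).subtypeₗᵢ := by
  refine OrthogonalFamily.of_pairwise fun i j hij => ?_
  refine Submodule.topologicalClosure_minimal _ (Submodule.span_le.2 ?_)
    (Submodule.isClosed_orthogonal _)
  rintro _ ⟨a, l, h, rfl⟩
  exact isOrtho_wordSpaceAt hfree hstar h (by simpa using hij.symm)

theorem starProjection_wordVec_of_head_ne (hfree : IsFreeFamily f.toLinearMap S)
    (hstar : ∀ i, ∀ x ∈ S i, star x ∈ S i) {i : ι} {l : List (ι × A)} (h : IsAltWord f S l)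
    (hl : ∀ b ∈ l.head?, i ≠ b.1) : (wordSpaceAt f S i).starProjection (wordVec f l) = 0 :=
  (Submodule.starProjection_apply_eq_zero_iff _).2 (isOrtho_wordSpaceAt hfree hstar h hl)

theorem gns_sub_starProjection_mem (hfree : IsFreeFamily f.toLinearMap S)
    (hstar : ∀ i, ∀ x ∈ S i, star x ∈ S i) {i : ι} {y : A} (hy : y ∈ S i) (hy0 : f y = 0)
    {x : f.GNS} (hx : x ∈ wordSpace f S) :
    f.gnsStarAlgHom y (x - (wordSpaceAt f S i).starProjection x) ∈ wordSpaceAt f S i := by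
  have hc : IsClosed ((wordSpaceAt f S i : Submodule ℂ f.GNS) : Set f.GNS) :=
    Submodule.isClosed_topologicalClosure _
  let L : f.GNS →L[ℂ] f.GNS :=
    f.gnsStarAlgHom y ∘L (ContinuousLinearMap.id ℂ _ - (wordSpaceAt f S i).starProjection)
  suffices wordSpace f S ≤ (wordSpaceAt f S i).comap (L : f.GNS →ₗ[ℂ] f.GNS) from this hx
  refine wordSpace_le (hc.preimage L.continuous) fun l hl => ?_
  show f.gnsStarAlgHom y (wordVec f l - (wordSpaceAt f S i).starProjection (wordVec f l)) ∈
    wordSpaceAt f S i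
  by_cases hd : ∀ b ∈ l.head?, i ≠ b.1
  · rw [starProjection_wordVec_of_head_ne hfree hstar hl hd, sub_zero, gns_wordVec y i]
    exact wordVec_cons_mem (hl.cons hy hy0 hd)
  · push Not at hd
    obtain ⟨b, hb, rfl⟩ := hd
    obtain ⟨l', rfl⟩ := List.head?_eq_some_iff.1 hb
    rw [Submodule.starProjection_eq_self_iff.2 (wordVec_cons_mem hl), sub_self, map_zero]
    exact zero_mem _

theorem gns_wordVec_mem_of_head_ne (hf1 : f 1 = 1) {i : ι} {y : A} (hy : y ∈ S i)
    {l : List (ι × A)} (h : IsAltWord f S l) (hl : ∀ b ∈ l.head?, i ≠ b.1) :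
    f.gnsStarAlgHom y (wordVec f l) ∈ wordSpace f S := by
  have hdec : y = (y - f y • (1 : A)) + f y • (1 : A) := by abel
  rw [hdec, gns_add_apply, gns_smul_apply, gns_one_apply]
  refine Submodule.add_mem _ ?_ (Submodule.smul_mem _ _ (wordVec_mem h))
  rw [gns_wordVec _ i]
  refine wordVec_mem (h.cons ?_ ?_ hl)
  · exact sub_mem hy ((S i).smul_mem (one_mem _) _)
  · simp [hf1]

theorem gns_mem_wordSpace (hf1 : f 1 = 1) {i : ι} {y : A} (hy : y ∈ S i)
    {x : f.GNS} (hx : x ∈ wordSpace f S) : f.gnsStarAlgHom y x ∈ wordSpace f S := by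
  have hc : IsClosed ((wordSpace f S : Submodule ℂ f.GNS) : Set f.GNS) :=
    Submodule.isClosed_topologicalClosure _
  suffices wordSpace f S ≤ (wordSpace f S).comap (f.gnsStarAlgHom y : f.GNS →ₗ[ℂ] f.GNS) from
    this hx
  refine wordSpace_le (hc.preimage (f.gnsStarAlgHom y).continuous) fun l hl => ?_
  show f.gnsStarAlgHom y (wordVec f l) ∈ wordSpace f S
  by_cases hd : ∀ b ∈ l.head?, i ≠ b.1
  · exact gns_wordVec_mem_of_head_ne hf1 hy hl hd
  · push Not at hd
    obtain ⟨⟨i, b⟩, hb, rfl⟩ := hd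
    obtain ⟨l', rfl⟩ := List.head?_eq_some_iff.1 hb
    rw [← gns_wordVec b i l', ← gns_mul_apply]
    exact gns_wordVec_mem_of_head_ne hf1 (mul_mem hy (hl.2 _ List.mem_cons_self).1) hl.tail
      (List.isChain_cons.1 hl.1).1

theorem isFreeFock_gns (hf1 : f 1 = 1) (hfree : IsFreeFamily f.toLinearMap S)
    (hstar : ∀ i, ∀ x ∈ S i, star x ∈ S i) {y : ι → A} {τ : ι → ℝ} (hy : ∀ i, y i ∈ S i)
    (hsa : ∀ i, IsSelfAdjoint (y i)) (hy0 : ∀ i, f (y i) = 0)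
    (hτ : ∀ i, f (y i ^ 2) = ((τ i ^ 2 : ℝ) : ℂ)) :
    IsFreeFock (wordSpaceAt f S) (wordSpace f S) (fun i => f.gnsStarAlgHom (y i)) τ where
  orth := orthogonalFamily_wordSpaceAt hfree hstar
  le := wordSpaceAt_le f S
  symm i x z := by rw [inner_gns_apply, (hsa i).star_eq]
  maps i x hx := gns_mem_wordSpace hf1 (hy i) hx
  creates i x hx := gns_sub_starProjection_mem hfree hstar (hy i) (hy0 i) hx
  sq i x hx := by
    have h := gns_sub_starProjection_mem hfree hstar (i := i)
      (y := y i ^ 2 - ((τ i ^ 2 : ℝ) : ℂ) • (1 : A))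
      (sub_mem (pow_mem (hy i) 2) ((S i).smul_mem (one_mem _) _)) ?_ hx
    · rwa [gns_sub_apply, gns_smul_apply, gns_one_apply, sq, gns_mul_apply] at h
    · rw [map_sub, map_smul, hτ, hf1]; simp

end Words

section Norm

open scoped InnerProductSpace ComplexOrder

theorem gnsVacuum_mem {A ι : Type*} [CStarAlgebra A] [PartialOrder A] [StarOrderedRing A]
    (f : A →ₚ[ℂ] ℂ) (S : ι → Subalgebra ℂ A) : gnsVacuum f ∈ wordSpace f S := by
  have := wordVec_mem (IsAltWord.nil (f := f) (S := S))
  simpa [wordVec, -PositiveLinearMap.gnsStarAlgHom_apply] using this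

theorem starProjection_gnsVacuum {A ι : Type*} [CStarAlgebra A] [PartialOrder A]
    [StarOrderedRing A] {f : A →ₚ[ℂ] ℂ} {S : ι → Subalgebra ℂ A}
    (hfree : IsFreeFamily f.toLinearMap S)
    (hstar : ∀ i, ∀ x ∈ S i, star x ∈ S i) (i : ι) :
    (wordSpaceAt f S i).starProjection (gnsVacuum f) = 0 := by
  have := starProjection_wordVec_of_head_ne hfree hstar (i := i)
    (IsAltWord.nil (f := f) (S := S)) (by simp)
  simpa [wordVec, -PositiveLinearMap.gnsStarAlgHom_apply] using this

variable {A : Type*} [CStarAlgebra A] [PartialOrder A] [StarOrderedRing A] {f : A →ₚ[ℂ] ℂ}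

theorem norm_gnsVacuum (hf1 : f 1 = 1) : ‖gnsVacuum f‖ = 1 := by
  have h : ⟪gnsVacuum f, gnsVacuum f⟫_ℂ = 1 := by
    conv_lhs => rw [← gns_one_apply f (gnsVacuum f)]
    rw [inner_gns_vacuum_vacuum]; simpa using hf1
  rw [inner_self_eq_norm_sq_to_K] at h
  have h' : ‖gnsVacuum f‖ ^ 2 = 1 := Complex.ofReal_injective (by simpa using h)
  exact (pow_eq_one_iff_of_nonneg (norm_nonneg _) two_ne_zero).1 h'

theorem norm_state_apply_le (hf1 : f 1 = 1) (a : A) : ‖f a‖ ≤ ‖a‖ := by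
  rw [← inner_gnsVacuum]
  refine (norm_inner_le_norm _ _).trans ?_
  rw [norm_gnsVacuum hf1, one_mul]
  refine ((f.gnsStarAlgHom a).le_opNorm _).trans ?_
  rw [norm_gnsVacuum hf1, mul_one]
  exact NonUnitalStarAlgHom.norm_apply_le f.gnsStarAlgHom a

/-- A quantitative form of `c ^ (2 * k) * g (t) ^ 2 ≤ ‖x‖ ^ 2 * t ^ (2 * k)` for functions `g`
supported off `[-c, c]`. -/
theorem smul_cfc_sq_le {x : A} (hx : IsSelfAdjoint x) {g : ℝ → ℝ} (hgc : Continuous g) {c R : ℝ}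
    (hc : 0 ≤ c) (k : ℕ) (h0 : ∀ t, |t| ≤ c → g t = 0) (hg0 : ∀ t, 0 ≤ g t)
    (hgR : ∀ t ∈ spectrum ℝ x, g t ≤ R) :
    c ^ (2 * k) • cfc g x ^ 2 ≤ R ^ 2 • x ^ (2 * k) := by
  rw [← cfc_pow g 2 x hgc.continuousOn hx, ← cfc_pow_id (R := ℝ) x (2 * k) hx,
    ← cfc_smul (c ^ (2 * k)) (fun t => g t ^ 2) x (hgc.pow 2).continuousOn,
    ← cfc_smul (R ^ 2) (fun t : ℝ => t ^ (2 * k)) x (continuous_pow _).continuousOn]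
  refine cfc_mono (fun t ht => ?_) (by fun_prop) (by fun_prop)
  simp only [smul_eq_mul]
  have hpow := (even_two_mul k).pow_nonneg t
  rcases le_total |t| c with htc | htc
  · rw [h0 t htc]
    simpa using by positivity
  · have h6 : c ^ (2 * k) ≤ t ^ (2 * k) := by
      rw [← (even_two_mul k).pow_abs t]
      gcongr
    rw [mul_comm]
    exact mul_le_mul (pow_le_pow_left₀ (hg0 t) (hgR t ht) 2) h6 (by positivity) (by positivity)

/-- For a faithful positive functional the norm of a self-adjoint element is bounded by the growth
rate of its even moments. -/
theorem norm_le_of_moment_le (hf : ∀ x, f (star x * x) = 0 → x = 0) {x : A}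
    (hx : IsSelfAdjoint x) {C : ℝ} (hC : 0 ≤ C)
    (h : ∀ k : ℕ, (f (x ^ (2 * k))).re ≤ C ^ (2 * k)) : ‖x‖ ≤ C := by
  by_contra! hlt
  obtain ⟨c, hCc, hcx⟩ := exists_between hlt
  have hc : 0 < c := hC.trans_lt hCc
  set g : ℝ → ℝ := fun t => max (|t| - c) 0 with hg
  have hgc : Continuous g := by fun_prop
  have hspec : ∀ t ∈ spectrum ℝ x, |t| ≤ ‖x‖ := fun t ht => by
    have := spectrum.norm_le_norm_mul_of_mem ht
    rcases subsingleton_or_nontrivial A with hA | hA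
    · exact absurd (Subsingleton.elim x 0 ▸ norm_zero) (hc.trans hcx).ne'
    · simpa using this
  set a := cfc g x with ha
  have ha0 : a ≠ 0 := by
    intro h0
    refine hcx.not_ge ?_
    rw [← cfc_id ℝ x]
    refine norm_cfc_le hc.le fun t ht => ?_
    have h1 := norm_apply_le_norm_cfc g x ht
    rw [← ha, h0, norm_zero, norm_le_zero_iff] at h1
    have h2 : |t| - c ≤ g t := le_max_left _ _
    simp only [id, Real.norm_eq_abs]
    linarith
  have hstar : star a * a = a ^ 2 := by
    rw [(cfc_predicate g x : IsSelfAdjoint a).star_eq, ← sq]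
  have hle : ∀ k : ℕ, c ^ (2 * k) * (f (star a * a)).re ≤ ‖x‖ ^ 2 * C ^ (2 * k) := by
    intro k
    have h1 : (c ^ (2 * k)) • (star a * a) ≤ (‖x‖ ^ 2) • x ^ (2 * k) := by
      rw [hstar]
      exact smul_cfc_sq_le hx hgc hc.le k (fun t ht => max_eq_right (by linarith))
        (fun t => le_max_right _ _) fun t ht => max_le (by linarith [hspec t ht]) (norm_nonneg _)
    have h2 := OrderHomClass.mono f h1
    rw [← Complex.coe_smul, ← Complex.coe_smul, map_smul, map_smul] at h2
    have h3 := (Complex.le_def.1 h2).1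
    simp only [smul_eq_mul, Complex.re_ofReal_mul] at h3
    exact h3.trans (by gcongr; exact h k)
  have hpos : 0 ≤ f (star a * a) := f.map_nonneg (star_mul_self_nonneg a)
  have hlim : Tendsto (fun k : ℕ => ‖x‖ ^ 2 * ((C / c) ^ 2) ^ k) atTop (𝓝 0) := by
    rw [← mul_zero (‖x‖ ^ 2)]
    refine (tendsto_pow_atTop_nhds_zero_of_lt_one (by positivity) ?_).const_mul _
    exact pow_lt_one₀ (by positivity) ((div_lt_one hc).2 hCc) two_ne_zero
  have hre : (f (star a * a)).re ≤ 0 := by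
    refine ge_of_tendsto' hlim fun k => ?_
    have := hle k
    rw [← pow_mul, div_pow, mul_div_assoc', le_div_iff₀ (by positivity)]
    linarith
  refine ha0 (hf a (le_antisymm ?_ hpos))
  rw [Complex.le_def] at hpos ⊢
  exact ⟨hre, hpos.2.symm⟩

variable {ι : Type*} {S : ι → Subalgebra ℂ A}

/-- Voiculescu's inequality for sums of free centred variables. -/
theorem norm_sum_le_of_free (hf : ∀ x, f (star x * x) = 0 → x = 0) (hf1 : f 1 = 1)
    (hfree : IsFreeFamily f.toLinearMap S)
    (hstar : ∀ i, ∀ x ∈ S i, star x ∈ S i) {y : ι → A} {τ : ι → ℝ} (hy : ∀ i, y i ∈ S i)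
    (hsa : ∀ i, IsSelfAdjoint (y i)) (hy0 : ∀ i, f (y i) = 0)
    (hτ : ∀ i, f (y i ^ 2) = ((τ i ^ 2 : ℝ) : ℂ)) (s : Finset ι) {M : ℝ} (hM0 : 0 ≤ M)
    (hM : ∀ i ∈ s, ‖y i‖ ≤ M) : ‖∑ i ∈ s, y i‖ ≤ M + 2 * √(∑ i ∈ s, τ i ^ 2) := by
  have hF := isFreeFock_gns hf1 hfree hstar hy hsa hy0 hτ
  have hx : IsSelfAdjoint (∑ i ∈ s, y i) := isSelfAdjoint_sum s fun i _ => hsa i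
  set C := M + 2 * √(∑ i ∈ s, τ i ^ 2) with hC
  have hC0 : 0 ≤ C := by positivity
  have hpow : ∀ k : ℕ, f.gnsStarAlgHom ((∑ i ∈ s, y i) ^ k) (gnsVacuum f) ∈ wordSpace f S ∧
      ‖f.gnsStarAlgHom ((∑ i ∈ s, y i) ^ k) (gnsVacuum f)‖ ≤ C ^ k := by
    intro k
    induction k with
    | zero =>
      rw [pow_zero, gns_one_apply, pow_zero]
      exact ⟨gnsVacuum_mem f S, (norm_gnsVacuum hf1).le⟩
    | succ k ih =>
      rw [pow_succ', gns_mul_apply, map_sum, _root_.sum_apply]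
      refine ⟨Submodule.sum_mem _ fun i _ => hF.maps i _ ih.1, ?_⟩
      refine (hF.norm_sum_apply_le s hM0 (fun i hi =>
        (NonUnitalStarAlgHom.norm_apply_le f.gnsStarAlgHom (y i)).trans (hM i hi)) ih.1).trans ?_
      rw [pow_succ' C]
      gcongr
      exact ih.2
  refine norm_le_of_moment_le hf hx hC0 fun k => ?_
  have h1 : f ((∑ i ∈ s, y i) ^ (2 * k)) =
      ((‖f.gnsStarAlgHom ((∑ i ∈ s, y i) ^ k) (gnsVacuum f)‖ ^ 2 : ℝ) : ℂ) := by
    have h2 := inner_gns_vacuum_vacuum f ((∑ i ∈ s, y i) ^ k) ((∑ i ∈ s, y i) ^ k)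
    rw [(hx.pow k).star_eq, ← pow_add, ← two_mul] at h2
    rw [← h2, inner_self_eq_norm_sq_to_K]
    simp
  rw [h1, Complex.ofReal_re, mul_comm, pow_mul]
  exact pow_le_pow_left₀ (norm_nonneg _) (hpow k).2 2

theorem norm_state_chebyshev_le (hf1 : f 1 = 1)
    (hfree : IsFreeFamily f.toLinearMap S)
    (hstar : ∀ i, ∀ x ∈ S i, star x ∈ S i) {y : ι → A} {τ : ι → ℝ} (hy : ∀ i, y i ∈ S i)
    (hsa : ∀ i, IsSelfAdjoint (y i)) (hy0 : ∀ i, f (y i) = 0)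
    (hτ : ∀ i, f (y i ^ 2) = ((τ i ^ 2 : ℝ) : ℂ)) (s : Finset ι)
    (hτ1 : ∑ i ∈ s, τ i ^ 2 = 1) (hM : ∀ i ∈ s, ‖y i‖ ≤ 1) (k : ℕ) :
    ‖f (Polynomial.aeval (∑ i ∈ s, y i) (Polynomial.Chebyshev.S ℝ ((k + 1 : ℕ) : ℤ)))‖ ≤
      4 ^ (k + 1) * √(∑ i ∈ s, ‖y i‖ ^ 4) := by
  have hF := isFreeFock_gns hf1 hfree hstar hy hsa hy0 hτ
  have hnorm : ∀ i, ‖f.gnsStarAlgHom (y i)‖ ≤ ‖y i‖ := fun i =>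
    NonUnitalStarAlgHom.norm_apply_le f.gnsStarAlgHom (y i)
  rw [← inner_gnsVacuum]
  refine hF.norm_inner_chebyshev_le s (Ω := gnsVacuum f) (ε := fun i => ‖y i‖)
    (gnsVacuum_mem f S) (norm_gnsVacuum hf1)
    (fun i => starProjection_gnsVacuum hfree hstar i) hτ1 (fun i _ => hnorm i) (fun i _ => ?_)
    (fun x hx => ?_)
    (u := fun k => f.gnsStarAlgHom
      (Polynomial.aeval (∑ i ∈ s, y i) (Polynomial.Chebyshev.S ℝ (k : ℤ))) (gnsVacuum f))
    ?_ ?_ (fun k => ?_) k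
  · have h1 := norm_state_apply_le hf1 (y i ^ 2)
    rw [hτ, Complex.norm_real, Real.norm_of_nonneg (sq_nonneg _)] at h1
    exact h1.trans (norm_pow_le' _ two_pos)
  · have h1 := hF.norm_sum_apply_le s zero_le_one (fun i hi => (hnorm i).trans (hM i hi)) hx
    rw [hτ1, Real.sqrt_one] at h1
    linarith
  · simp
  · simp
  · have h1 : Polynomial.Chebyshev.S ℝ ((k + 2 : ℕ) : ℤ) = Polynomial.X *
        Polynomial.Chebyshev.S ℝ ((k + 1 : ℕ) : ℤ) - Polynomial.Chebyshev.S ℝ (k : ℤ) := by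
      push_cast
      exact Polynomial.Chebyshev.S_add_two ℝ k
    show f.gnsStarAlgHom (Polynomial.aeval _ (Polynomial.Chebyshev.S ℝ ((k + 2 : ℕ) : ℤ))) _ = _
    rw [h1, map_sub, map_mul, Polynomial.aeval_X, gns_sub_apply, gns_mul_apply, map_sum,
      _root_.sum_apply]

end Norm

section Semicircle

theorem semicircleLaw_density_nonneg (t : ℝ) :
    0 ≤ (Set.Icc (-2 : ℝ) 2).indicator (fun t => (2 * Real.pi)⁻¹ * √(4 - t ^ 2)) t :=
  Set.indicator_nonneg (fun t _ => by positivity) t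

theorem measurable_semicircleLaw_density :
    Measurable ((Set.Icc (-2 : ℝ) 2).indicator fun t => (2 * Real.pi)⁻¹ * √(4 - t ^ 2)) :=
  Measurable.indicator (by fun_prop) measurableSet_Icc

theorem integral_semicircleLaw (g : ℝ → ℝ) :
    ∫ t, g t ∂semicircleLaw = ∫ t in (-2 : ℝ)..2, g t * ((2 * Real.pi)⁻¹ * √(4 - t ^ 2)) := by
  rw [semicircleLaw, integral_withDensity_eq_integral_toReal_smul
    measurable_semicircleLaw_density.ennreal_ofReal (by simp),
    intervalIntegral.integral_of_le (by norm_num), ← integral_Icc_eq_integral_Ioc,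
    ← integral_indicator measurableSet_Icc]
  refine integral_congr_ae (.of_forall fun t => ?_)
  simp only [ENNReal.toReal_ofReal (semicircleLaw_density_nonneg t)]
  by_cases ht : t ∈ Set.Icc (-2 : ℝ) 2 <;> simp [ht, mul_comm]

theorem integrable_semicircleLaw {g : ℝ → ℝ} (hg : Continuous g) : Integrable g semicircleLaw := by
  rw [semicircleLaw, integrable_withDensity_iff_integrable_smul'
    measurable_semicircleLaw_density.ennreal_ofReal (by simp)]
  have h : IntegrableOn (fun t => g t * ((2 * Real.pi)⁻¹ * √(4 - t ^ 2))) (Set.Icc (-2) 2) :=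
    ContinuousOn.integrableOn_Icc (by fun_prop)
  rw [← integrable_indicator_iff measurableSet_Icc] at h
  refine h.congr (.of_forall fun t => ?_)
  simp only [ENNReal.toReal_ofReal (semicircleLaw_density_nonneg t)]
  by_cases ht : t ∈ Set.Icc (-2 : ℝ) 2 <;> simp [ht, mul_comm]

theorem ae_semicircleLaw_mem_Icc : ∀ᵐ t ∂semicircleLaw, t ∈ Set.Icc (-2 : ℝ) 2 := by
  rw [semicircleLaw, ae_withDensity_iff measurable_semicircleLaw_density.ennreal_ofReal]
  refine .of_forall fun t h => ?_
  by_contra ht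
  simp [ht] at h

/-- The substitution `t = 2 cos θ`. -/
theorem integral_semicircleLaw_eq_integral_cos {g : ℝ → ℝ} (hg : Continuous g) :
    ∫ t, g t ∂semicircleLaw =
      2 / Real.pi * ∫ θ in (0 : ℝ)..Real.pi, g (2 * Real.cos θ) * Real.sin θ ^ 2 := by
  have h := intervalIntegral.integral_comp_mul_deriv (a := 0) (b := Real.pi)
    (f := fun θ => 2 * Real.cos θ) (f' := fun θ => 2 * -Real.sin θ)
    (g := fun t => g t * ((2 * Real.pi)⁻¹ * √(4 - t ^ 2)))
    (fun θ _ => (Real.hasDerivAt_cos θ).const_mul 2) (by fun_prop) (by fun_prop)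
  simp only [Real.cos_zero, Real.cos_pi, mul_one, mul_neg] at h
  rw [integral_semicircleLaw, intervalIntegral.integral_symm, ← h,
    ← intervalIntegral.integral_neg, ← intervalIntegral.integral_const_mul]
  refine intervalIntegral.integral_congr fun θ hθ => ?_
  rw [Set.uIcc_of_le Real.pi_pos.le] at hθ
  have hs := Real.sin_nonneg_of_mem_Icc hθ
  have hsq : √(4 - (2 * Real.cos θ) ^ 2) = 2 * Real.sin θ := by
    rw [show 4 - (2 * Real.cos θ) ^ 2 = (2 * Real.sin θ) ^ 2 by
      nlinarith [Real.sin_sq_add_cos_sq θ], Real.sqrt_sq (by positivity)]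
  simp only [Function.comp, hsq]
  field_simp

theorem integral_cos_natCast_mul {k : ℕ} (hk : k ≠ 0) :
    ∫ θ in (0 : ℝ)..Real.pi, Real.cos (k * θ) = 0 := by
  have hk' : (k : ℝ) ≠ 0 := Nat.cast_ne_zero.2 hk
  rw [intervalIntegral.integral_comp_mul_left (fun θ => Real.cos θ) hk']
  simp [Real.sin_nat_mul_pi]

theorem integral_sin_natCast_mul_mul_sin (k : ℕ) :
    ∫ θ in (0 : ℝ)..Real.pi, Real.sin ((k + 1 : ℕ) * θ) * Real.sin θ =
      if k = 0 then Real.pi / 2 else 0 := by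
  have h : ∀ θ : ℝ, Real.sin ((k + 1 : ℕ) * θ) * Real.sin θ =
      2⁻¹ * (Real.cos (k * θ) - Real.cos ((k + 2 : ℕ) * θ)) := fun θ => by
    have h1 : (k : ℝ) * θ = (k + 1 : ℕ) * θ - θ := by push_cast; ring
    have h2 : ((k + 2 : ℕ) : ℝ) * θ = (k + 1 : ℕ) * θ + θ := by push_cast; ring
    rw [h1, h2, Real.cos_sub, Real.cos_add]
    ring
  simp only [h]
  rw [intervalIntegral.integral_const_mul, intervalIntegral.integral_sub
    (by apply Continuous.intervalIntegrable; fun_prop)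
    (by apply Continuous.intervalIntegrable; fun_prop),
    integral_cos_natCast_mul (Nat.succ_ne_zero _), sub_zero]
  split_ifs with hk
  · subst hk
    simp
    ring
  · rw [integral_cos_natCast_mul hk, mul_zero]

theorem integral_chebyshev_semicircleLaw (k : ℕ) :
    ∫ t, (Polynomial.Chebyshev.S ℝ (k : ℤ)).eval t ∂semicircleLaw = if k = 0 then 1 else 0 := by
  rw [integral_semicircleLaw_eq_integral_cos (Polynomial.continuous _)]
  have h : ∀ θ : ℝ, (Polynomial.Chebyshev.S ℝ (k : ℤ)).eval (2 * Real.cos θ) * Real.sin θ ^ 2 =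
      Real.sin ((k + 1 : ℕ) * θ) * Real.sin θ := fun θ => by
    rw [sq, ← mul_assoc, Polynomial.Chebyshev.S_two_mul_real_cos]
    push_cast
    rfl
  simp only [h, integral_sin_natCast_mul_mul_sin]
  have := Real.pi_ne_zero
  split_ifs
  · field_simp
  · simp

instance isProbabilityMeasure_semicircleLaw : IsProbabilityMeasure semicircleLaw := by
  have : IsFiniteMeasure semicircleLaw :=
    (integrable_const_iff_isFiniteMeasure one_ne_zero).1
      (integrable_semicircleLaw (continuous_const (y := (1 : ℝ))))
  have h := integral_chebyshev_semicircleLaw 0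
  simp only [Nat.cast_zero, Polynomial.Chebyshev.S_zero, Polynomial.eval_one, integral_const,
    smul_eq_mul, mul_one, if_true] at h
  exact ⟨by simpa [measureReal_def] using congrArg ENNReal.ofReal h⟩

/-- Every polynomial is a linear combination of Chebyshev polynomials. -/
theorem span_chebyshev_S :
    Submodule.span ℝ (Set.range fun k : ℕ => Polynomial.Chebyshev.S ℝ (k : ℤ)) = ⊤ := by
  set M := Submodule.span ℝ (Set.range fun k : ℕ => Polynomial.Chebyshev.S ℝ (k : ℤ))
  have hS : ∀ k : ℕ, Polynomial.Chebyshev.S ℝ (k : ℤ) ∈ M := fun k =>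
    Submodule.subset_span ⟨k, rfl⟩
  have hX : ∀ p ∈ M, Polynomial.X * p ∈ M := fun p hp => by
    induction hp using Submodule.span_induction with
    | mem p hp =>
      obtain ⟨k, rfl⟩ := hp
      rcases k with - | k
      · simpa using hS 1
      · have h : Polynomial.X * Polynomial.Chebyshev.S ℝ ((k + 1 : ℕ) : ℤ) =
            Polynomial.Chebyshev.S ℝ ((k + 2 : ℕ) : ℤ) + Polynomial.Chebyshev.S ℝ (k : ℤ) := by
          push_cast
          rw [Polynomial.Chebyshev.S_add_two]
          ring
        simp only [h]
        exact M.add_mem (hS _) (hS _)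
    | zero => simp
    | add p q _ _ hp hq => rw [mul_add]; exact M.add_mem hp hq
    | smul c p _ hp => rw [mul_smul_comm]; exact M.smul_mem c hp
  have hXpow : ∀ n : ℕ, (Polynomial.X : Polynomial ℝ) ^ n ∈ M := fun n => by
    induction n with
    | zero => simpa using hS 0
    | succ n ih => rw [pow_succ']; exact hX _ ih
  refine Submodule.eq_top_iff'.2 fun p => ?_
  rw [p.as_sum_range_C_mul_X_pow]
  refine Submodule.sum_mem _ fun i _ => ?_
  rw [← Polynomial.smul_eq_C_mul]
  exact M.smul_mem _ (hXpow i)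

theorem tendsto_integral_polynomial_of_chebyshev {L : ℕ → Polynomial ℝ →ₗ[ℝ] ℂ}
    (h0 : ∀ᶠ n in atTop, L n 1 = 1)
    (h : ∀ k : ℕ, Tendsto (fun n => L n (Polynomial.Chebyshev.S ℝ ((k + 1 : ℕ) : ℤ))) atTop (𝓝 0))
    (p : Polynomial ℝ) :
    Tendsto (fun n => L n p) atTop (𝓝 ((∫ t, p.eval t ∂semicircleLaw : ℝ) : ℂ)) := by
  have hp : p ∈ Submodule.span ℝ
      (Set.range fun k : ℕ => Polynomial.Chebyshev.S ℝ (k : ℤ)) := span_chebyshev_S ▸ trivial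
  induction hp using Submodule.span_induction with
  | mem p hp =>
    obtain ⟨k, rfl⟩ := hp
    simp only [integral_chebyshev_semicircleLaw]
    rcases k with - | k
    · simpa using tendsto_const_nhds.congr' (h0.mono fun n hn => hn.symm)
    · simpa using h k
  | zero => simp
  | add p q _ _ hp hq =>
    simp only [map_add, Polynomial.eval_add]
    rw [integral_add (integrable_semicircleLaw p.continuous)
      (integrable_semicircleLaw q.continuous), Complex.ofReal_add]
    exact hp.add hq
  | smul c p _ hp =>
    simp only [map_smul, Polynomial.eval_smul, smul_eq_mul]
    rw [integral_const_mul, Complex.ofReal_mul, ← smul_eq_mul, Complex.coe_smul]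
    exact hp.const_smul c

end Semicircle

section Weak

/-- A probability measure whose even moments are nonzero and bounded by `R ^ (2 * k)` lives on
`[-c, c]` for `c > R`. Nonvanishing of the moments encodes integrability. -/
theorem ae_abs_lt_of_moment_le {μ : Measure ℝ} [IsFiniteMeasure μ] {R c : ℝ} (hR : 0 ≤ R)
    (hRc : R < c) (h0 : ∀ k : ℕ, ∫ t, t ^ (2 * k) ∂μ ≠ 0)
    (h : ∀ k : ℕ, ∫ t, t ^ (2 * k) ∂μ ≤ R ^ (2 * k)) : ∀ᵐ t ∂μ, |t| < c := by
  have hc : 0 < c := hR.trans_lt hRc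
  have hmarkov : ∀ k : ℕ, μ.real {t | c ≤ |t|} ≤ ((R / c) ^ 2) ^ k := fun k => by
    have h1 := mul_meas_ge_le_integral_of_nonneg (μ := μ) (f := fun t : ℝ => t ^ (2 * k))
      (.of_forall fun t => (even_two_mul k).pow_nonneg t)
      (not_imp_comm.1 integral_undef (h0 k)) (c ^ (2 * k))
    have h2 : μ.real {t | c ≤ |t|} ≤ μ.real {t | c ^ (2 * k) ≤ t ^ (2 * k)} := by
      refine measureReal_mono fun t (ht : c ≤ |t|) => ?_
      rw [Set.mem_ofPred_eq, ← (even_two_mul k).pow_abs t]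
      gcongr
    rw [← pow_mul, div_pow, le_div_iff₀ (by positivity), mul_comm]
    exact (mul_le_mul_of_nonneg_left h2 (by positivity)).trans (h1.trans (h k))
  have hlim : Tendsto (fun k : ℕ => ((R / c) ^ 2) ^ k) atTop (𝓝 0) :=
    tendsto_pow_atTop_nhds_zero_of_lt_one (by positivity)
      (pow_lt_one₀ (by positivity) ((div_lt_one hc).2 hRc) two_ne_zero)
  have hzero : μ.real {t | c ≤ |t|} = 0 := le_antisymm (ge_of_tendsto' hlim hmarkov)
    measureReal_nonneg
  rw [ae_iff]
  simpa only [not_lt] using (measureReal_eq_zero_iff).1 hzero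

theorem abs_integral_sub_le_of_ae_mem_Icc {μ : Measure ℝ} [IsProbabilityMeasure μ] {f g : ℝ → ℝ}
    (hf : Continuous f) (hg : Continuous g) {R ε : ℝ} (hμ : ∀ᵐ t ∂μ, t ∈ Set.Icc (-R) R)
    (h : ∀ t ∈ Set.Icc (-R) R, |g t - f t| ≤ ε) :
    |∫ t, g t ∂μ - ∫ t, f t ∂μ| ≤ ε := by
  have hu_int : ∀ {u : ℝ → ℝ}, Continuous u → Integrable u μ := fun {u} hu => by
    obtain ⟨C, hC⟩ := (isCompact_Icc (a := -R) (b := R)).exists_bound_of_continuousOn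
      hu.continuousOn
    exact .of_bound hu.aestronglyMeasurable C (hμ.mono hC)
  rw [← integral_sub (hu_int hg) (hu_int hf)]
  simpa using norm_integral_le_of_norm_le_const (μ := μ) (f := fun t => g t - f t)
    (hμ.mono fun t ht => h t ht)

/-- Convergence of polynomial integrals of probability measures with uniformly bounded supports
implies convergence of integrals of continuous functions. -/
theorem tendsto_integral_of_polynomial {μ : ℕ → Measure ℝ} {ν : Measure ℝ}
    [IsProbabilityMeasure ν] {R : ℝ} (hν : ∀ᵐ t ∂ν, t ∈ Set.Icc (-R) R)
    (hμ : ∀ᶠ n in atTop, IsProbabilityMeasure (μ n) ∧ ∀ᵐ t ∂μ n, t ∈ Set.Icc (-R) R)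
    (h : ∀ p : Polynomial ℝ,
      Tendsto (fun n => ∫ t, p.eval t ∂μ n) atTop (𝓝 (∫ t, p.eval t ∂ν)))
    {f : ℝ → ℝ} (hf : Continuous f) :
    Tendsto (fun n => ∫ t, f t ∂μ n) atTop (𝓝 (∫ t, f t ∂ν)) := by
  rw [Metric.tendsto_atTop']
  refine fun ε hε => ?_
  obtain ⟨p, hp⟩ := exists_polynomial_near_of_continuousOn (-R) R f hf.continuousOn (ε / 4)
    (by positivity)
  have hconv := (Metric.tendsto_nhds.1 (h p)) (ε / 4) (by positivity)
  obtain ⟨N, hN⟩ := eventually_atTop.1 (hμ.and hconv)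
  refine ⟨N, fun n hn => ?_⟩
  obtain ⟨⟨hprob, hsupp⟩, hdist⟩ := hN n hn.le
  have h1 := abs_le.1 (abs_integral_sub_le_of_ae_mem_Icc hf p.continuous hsupp
    fun t ht => (hp t ht).le)
  have h2 := abs_le.1 (abs_integral_sub_le_of_ae_mem_Icc hf p.continuous hν
    fun t ht => (hp t ht).le)
  rw [Real.dist_eq] at hdist ⊢
  rw [abs_lt] at hdist ⊢
  constructor <;> linarith [h1.1, h1.2, h2.1, h2.2, hdist.1, hdist.2]

end Weak

section Perturbation

theorem norm_pow_sub_pow_le {A : Type*} [NormedRing A] [NormOneClass A] {a b : A} {R : ℝ}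
    (ha : ‖a‖ ≤ R) (hb : ‖b‖ ≤ R) (hR : 1 ≤ R) (k : ℕ) :
    ‖a ^ k - b ^ k‖ ≤ k * R ^ k * ‖a - b‖ := by
  induction k with
  | zero => simp
  | succ k ih =>
    have h : a ^ (k + 1) - b ^ (k + 1) = a ^ k * (a - b) + (a ^ k - b ^ k) * b := by
      rw [pow_succ, pow_succ]
      noncomm_ring
    have h1 : ‖a ^ k * (a - b)‖ ≤ R ^ k * R * ‖a - b‖ := by
      refine (norm_mul_le _ _).trans ?_
      gcongr
      exact (norm_pow_le a k).trans ((pow_le_pow_left₀ (norm_nonneg _) ha k).trans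
        (le_mul_of_one_le_right (by positivity) hR))
    have h2 : ‖(a ^ k - b ^ k) * b‖ ≤ k * R ^ k * ‖a - b‖ * R := by
      refine (norm_mul_le _ _).trans ?_
      gcongr
    rw [h, pow_succ]
    push_cast
    linarith [norm_add_le (a ^ k * (a - b)) ((a ^ k - b ^ k) * b)]

theorem tendsto_aeval_sub_aeval {A : Type*} [NormedRing A] [NormOneClass A] [NormedAlgebra ℝ A]
    {u s : ℕ → A} {R : ℝ} (hR : 1 ≤ R) (hu : ∀ᶠ n in atTop, ‖u n‖ ≤ R)
    (hs : ∀ᶠ n in atTop, ‖s n‖ ≤ R) (h : Tendsto (fun n => u n - s n) atTop (𝓝 0))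
    (p : Polynomial ℝ) :
    Tendsto (fun n => Polynomial.aeval (u n) p - Polynomial.aeval (s n) p) atTop (𝓝 0) := by
  induction p using Polynomial.induction_on' with
  | add p q hp hq =>
    have := hp.add hq
    rw [add_zero] at this
    refine this.congr fun n => ?_
    rw [map_add, map_add]
    abel
  | monomial k c =>
    have h1 : Tendsto (fun n => u n ^ k - s n ^ k) atTop (𝓝 0) := by
      refine squeeze_zero_norm' ((hu.and hs).mono fun n hn =>
        norm_pow_sub_pow_le hn.1 hn.2 hR k) ?_
      simpa using h.norm.const_mul (k * R ^ k)
    have h2 := h1.const_smul c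
    rw [smul_zero] at h2
    refine h2.congr fun n => ?_
    rw [Polynomial.aeval_monomial, Polynomial.aeval_monomial, ← Algebra.smul_def,
      ← Algebra.smul_def, smul_sub]

variable {A : Type*} [CStarAlgebra A]

theorem isUnit_of_norm_sub_one_lt {v : A} (h : ‖v - 1‖ < 1) : IsUnit v := by
  simpa using isUnit_one_sub_of_norm_lt_one (x := 1 - v) (by rwa [norm_sub_rev])

theorem norm_conj_sub_le [Nontrivial A] {w s : A} (hs : ‖s‖ ≤ 3) (hw : ‖w - 1‖ ≤ 1) :
    ‖w * s * w - s‖ ≤ 9 * ‖w - 1‖ := by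
  have h : w * s * w - s = (w - 1) * s * w + s * (w - 1) := by noncomm_ring
  have hw2 : ‖w‖ ≤ 2 := by
    have := norm_add_le (w - 1) 1
    rw [sub_add_cancel, norm_one] at this
    linarith
  have h1 : ‖(w - 1) * s * w‖ ≤ ‖w - 1‖ * 3 * 2 :=
    (norm_mul_le _ _).trans (mul_le_mul ((norm_mul_le _ _).trans (by gcongr)) hw2
      (norm_nonneg _) (by positivity))
  have h2 : ‖s * (w - 1)‖ ≤ 3 * ‖w - 1‖ := (norm_mul_le _ _).trans (by gcongr)
  rw [h]
  linarith [norm_add_le ((w - 1) * s * w) (s * (w - 1))]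

theorem IsSelfAdjoint.pow_ne_zero {x : A} (hx : IsSelfAdjoint x) (h0 : x ≠ 0) (k : ℕ) :
    x ^ k ≠ 0 := fun h => by
  have h1 : x ^ 2 ^ k = 0 := by
    rw [← Nat.add_sub_of_le k.lt_two_pow_self.le, pow_add, h, zero_mul]
  have h2 := hx.nnnorm_pow_two_pow k
  rw [h1, nnnorm_zero] at h2
  exact h0 (nnnorm_eq_zero.1 (pow_eq_zero_iff (by positivity) |>.1 h2.symm))

variable [PartialOrder A] [StarOrderedRing A]

theorem exists_inverse_fourth_root {v : A} (hv : IsStrictlyPositive v) :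
    ∃ w : A, 0 ≤ w ∧ w ^ 4 * v = 1 ∧ v * w ^ 4 = 1 := by
  have h4 : (v ^ (-(1 / 4) : ℝ)) ^ 4 = v ^ (-1 : ℝ) := by
    rw [← CFC.rpow_natCast _ 4 CFC.rpow_nonneg, CFC.rpow_rpow v _ _ (by norm_num) hv]
    norm_num
  have h1 := CFC.rpow_one v hv.nonneg
  refine ⟨v ^ (-(1 / 4) : ℝ), CFC.rpow_nonneg, ?_, ?_⟩
  · rw [h4]
    simpa only [h1] using CFC.rpow_neg_mul_rpow 1 hv
  · rw [h4]
    simpa only [h1] using CFC.rpow_mul_rpow_neg 1 hv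

theorem norm_sub_one_le_norm_pow_four_sub_one {w : A} (hw : 0 ≤ w) : ‖w - 1‖ ≤ ‖w ^ 4 - 1‖ := by
  have hsa := IsSelfAdjoint.of_nonneg hw
  have h1 : w - 1 = cfc (fun t : ℝ => t - 1) w := by
    rw [cfc_sub (fun t : ℝ => t) (fun _ => 1) w (by fun_prop) (by fun_prop), cfc_id' ℝ w hsa,
      cfc_const_one ℝ w hsa]
  have h2 : w ^ 4 - 1 = cfc (fun t : ℝ => t ^ 4 - 1) w := by
    rw [cfc_sub (fun t : ℝ => t ^ 4) (fun _ => 1) w (by fun_prop) (by fun_prop),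
      cfc_pow_id w 4 hsa, cfc_const_one ℝ w hsa]
  rw [h2, h1]
  refine norm_cfc_le (norm_nonneg _) fun t ht => ?_
  have ht0 : 0 ≤ t := spectrum_nonneg_of_nonneg hw ht
  refine le_trans ?_ (norm_apply_le_norm_cfc (fun t : ℝ => t ^ 4 - 1) w ht (by fun_prop) hsa)
  have h3 : t ^ 4 - 1 = (t - 1) * (1 + t + t ^ 2 + t ^ 3) := by ring
  simp only [Real.norm_eq_abs]
  rw [h3, abs_mul, abs_of_pos (a := 1 + t + t ^ 2 + t ^ 3) (by positivity)]
  exact le_mul_of_one_le_right (abs_nonneg _) (by linarith [pow_nonneg ht0 2, pow_nonneg ht0 3])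

theorem norm_inverse_fourth_root_sub_one_le [Nontrivial A] {v w : A} (hw : 0 ≤ w)
    (hwv : w ^ 4 * v = 1) (hv : ‖v - 1‖ ≤ 1 / 2) : ‖w - 1‖ ≤ 2 * ‖v - 1‖ := by
  refine (norm_sub_one_le_norm_pow_four_sub_one hw).trans ?_
  have h1 : w ^ 4 - 1 = (w ^ 4 - 1) * (1 - v) + (1 - v) := by
    have h : (w ^ 4 - 1) * (1 - v) + (1 - v) = w ^ 4 - w ^ 4 * v := by noncomm_ring
    rw [h, hwv]
  have h2 : ‖w ^ 4 - 1‖ ≤ ‖w ^ 4 - 1‖ * ‖v - 1‖ + ‖v - 1‖ := by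
    conv_lhs => rw [h1]
    refine (norm_add_le _ _).trans ?_
    rw [norm_sub_rev v 1]
    gcongr
    exact norm_mul_le _ _
  nlinarith [norm_nonneg (w ^ 4 - 1), norm_nonneg (v - 1)]

end Perturbation

section Distribution
open scoped ComplexOrder

variable {A : Type*} [CStarAlgebra A] [PartialOrder A] {f : A →ₚ[ℂ] ℂ}

theorem IsDistribution.map_aeval {x : A} {μ : Measure ℝ} (h : IsDistribution f.toLinearMap x μ)
    {c : ℝ} (hc : ∀ᵐ t ∂μ, |t| < c) (p : Polynomial ℝ) :
    f (Polynomial.aeval x p) = ((∫ t, p.eval t ∂μ : ℝ) : ℂ) := by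
  have := h.1
  have hu_int : ∀ {u : ℝ → ℝ}, Continuous u → Integrable u μ := fun {u} hu => by
    obtain ⟨C, hC⟩ := (isCompact_Icc (a := -c) (b := c)).exists_bound_of_continuousOn
      hu.continuousOn
    exact .of_bound hu.aestronglyMeasurable C (hc.mono fun t ht => hC t (abs_le.1 ht.le))
  induction p using Polynomial.induction_on' with
  | add p q hp hq =>
    simp only [map_add, Polynomial.eval_add]
    rw [integral_add (hu_int p.continuous) (hu_int q.continuous), Complex.ofReal_add, hp, hq]
  | monomial k a =>
    have h1 : f (x ^ k) = ((∫ t, t ^ k ∂μ : ℝ) : ℂ) := h.2 k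
    rw [Polynomial.aeval_monomial, ← Algebra.smul_def, ← Complex.coe_smul, map_smul, h1]
    simp only [Polynomial.eval_monomial, integral_const_mul, Complex.ofReal_mul, smul_eq_mul]

theorem IsDistribution.integral_even_pow_ne_zero (hf : ∀ x, f (star x * x) = 0 → x = 0) {x : A}
    (hx : IsSelfAdjoint x) (h0 : x ≠ 0) {μ : Measure ℝ} (h : IsDistribution f.toLinearMap x μ)
    (k : ℕ) : ∫ t, t ^ (2 * k) ∂μ ≠ 0 := fun hk => by
  have h1 : f (x ^ (2 * k)) = ((∫ t, t ^ (2 * k) ∂μ : ℝ) : ℂ) := h.2 (2 * k)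
  rw [hk, Complex.ofReal_zero, two_mul, pow_add] at h1
  nth_rw 1 [← (hx.pow k).star_eq] at h1
  exact hx.pow_ne_zero h0 k (hf _ h1)

variable [StarOrderedRing A]

theorem IsDistribution.ae_abs_lt [Nontrivial A] (hf : ∀ x, f (star x * x) = 0 → x = 0)
    (hf1 : f 1 = 1) {x : A}
    (hx : IsSelfAdjoint x) (h0 : x ≠ 0) {μ : Measure ℝ} (h : IsDistribution f.toLinearMap x μ)
    {c : ℝ} (hc : ‖x‖ < c) : ∀ᵐ t ∂μ, |t| < c := by
  have := h.1
  refine ae_abs_lt_of_moment_le (norm_nonneg x) hc (h.integral_even_pow_ne_zero hf hx h0)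
    fun k => ?_
  have h1 : f (x ^ (2 * k)) = ((∫ t, t ^ (2 * k) ∂μ : ℝ) : ℂ) := h.2 (2 * k)
  have h2 := (norm_state_apply_le hf1 (x ^ (2 * k))).trans (norm_pow_le x (2 * k))
  rw [h1, Complex.norm_real] at h2
  exact (le_abs_self _).trans h2

end Distribution

section FreeSums
open scoped ComplexOrder

variable {A ι : Type*} [CStarAlgebra A] [PartialOrder A] [StarOrderedRing A] {f : A →ₚ[ℂ] ℂ}
  {S : ι → Subalgebra ℂ A}

theorem norm_sum_sq_sub_one_le_of_free (hf : ∀ x, f (star x * x) = 0 → x = 0) (hf1 : f 1 = 1)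
    (hfree : IsFreeFamily f.toLinearMap S)
    (hstar : ∀ i, ∀ x ∈ S i, star x ∈ S i) {y : ι → A} {τ : ι → ℝ} (hy : ∀ i, y i ∈ S i)
    (hsa : ∀ i, IsSelfAdjoint (y i))
    (hτ : ∀ i, f (y i ^ 2) = ((τ i ^ 2 : ℝ) : ℂ)) (s : Finset ι)
    (hτ1 : ∑ i ∈ s, τ i ^ 2 = 1) :
    ‖∑ i ∈ s, y i ^ 2 - 1‖ ≤ 6 * √(∑ i ∈ s, ‖y i‖ ^ 4) := by
  have : Nontrivial A := ⟨1, 0, fun h => by simp [h] at hf1⟩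
  set z : ι → A := fun i => y i ^ 2 - ((τ i ^ 2 : ℝ) : ℂ) • (1 : A) with hz
  have hzS : ∀ i, z i ∈ S i := fun i =>
    (S i).sub_mem ((S i).pow_mem (hy i) 2) ((S i).smul_mem (S i).one_mem _)
  have hzsa : ∀ i, IsSelfAdjoint (z i) := fun i => by
    refine ((hsa i).pow 2).sub ?_
    rw [Complex.coe_smul]
    exact (IsSelfAdjoint.all (τ i ^ 2)).smul (IsSelfAdjoint.one A)
  have hz0 : ∀ i, f (z i) = 0 := fun i => by
    simp only [hz, map_sub, map_smul, hτ, hf1, smul_eq_mul, mul_one, sub_self]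
  have hzρ : ∀ i, f (z i ^ 2) = ((√(f (z i ^ 2)).re ^ 2 : ℝ) : ℂ) := fun i => by
    have h : 0 ≤ f (z i ^ 2) := f.map_nonneg (hzsa i).sq_nonneg
    rw [Complex.le_def] at h
    rw [Real.sq_sqrt h.1]
    exact Complex.ext rfl (by simpa using h.2.symm)
  have hτy : ∀ i, τ i ^ 2 ≤ ‖y i‖ ^ 2 := fun i => by
    have h := (norm_state_apply_le hf1 (y i ^ 2)).trans (norm_pow_le _ 2)
    rwa [hτ, Complex.norm_real, Real.norm_of_nonneg (sq_nonneg _)] at h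
  have hznorm : ∀ i, ‖z i‖ ≤ 2 * ‖y i‖ ^ 2 := fun i => by
    refine (norm_sub_le _ _).trans ?_
    rw [norm_smul, norm_one, mul_one, Complex.norm_real, Real.norm_of_nonneg (sq_nonneg _)]
    linarith [norm_pow_le (y i) 2, hτy i]
  have hρ : ∀ i, √(f (z i ^ 2)).re ^ 2 ≤ 4 * ‖y i‖ ^ 4 := fun i => by
    have h := (norm_state_apply_le hf1 (z i ^ 2)).trans (norm_pow_le _ 2)
    rw [hzρ, Complex.norm_real, Real.norm_of_nonneg (sq_nonneg _)] at h
    refine h.trans ((pow_le_pow_left₀ (norm_nonneg _) (hznorm i) 2).trans_eq ?_)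
    ring
  set L := ∑ i ∈ s, ‖y i‖ ^ 4 with hL
  have hsum : ∑ i ∈ s, z i = ∑ i ∈ s, y i ^ 2 - 1 := by
    simp only [hz]
    rw [Finset.sum_sub_distrib, ← Finset.sum_smul, ← Complex.ofReal_sum, hτ1, Complex.ofReal_one,
      one_smul]
  have hM : ∀ i ∈ s, ‖z i‖ ≤ 2 * √L := fun i hi => by
    refine (hznorm i).trans ?_
    gcongr
    refine Real.le_sqrt_of_sq_le ?_
    rw [← pow_mul]
    exact Finset.single_le_sum (f := fun i => ‖y i‖ ^ 4) (fun i _ => by positivity) hi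
  have h := norm_sum_le_of_free hf hf1 hfree hstar hzS hzsa hz0 hzρ s (by positivity) hM
  have h2 : √(∑ i ∈ s, √(f (z i ^ 2)).re ^ 2) ≤ 2 * √L := by
    rw [Real.sqrt_le_left (by positivity), mul_pow, Real.sq_sqrt (by positivity), hL,
      Finset.mul_sum]
    refine Finset.sum_le_sum fun i _ => (hρ i).trans_eq (by norm_num)
  rw [← hsum]
  linarith

theorem norm_le_one_of_sum_pow_four_le {E : Type*} [NormedAddCommGroup E] {y : ι → E}
    {s : Finset ι} (h : ∑ i ∈ s, ‖y i‖ ^ 4 ≤ 1) : ∀ i ∈ s, ‖y i‖ ≤ 1 := fun i hi =>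
  (pow_le_one_iff_of_nonneg (norm_nonneg _) (by norm_num : 4 ≠ 0)).1
    ((Finset.single_le_sum (f := fun i => ‖y i‖ ^ 4) (fun i _ => by positivity) hi).trans h)

/-- The free central limit theorem for triangular arrays with vanishing fourth Lyapunov fraction,
in self-normalised form. -/
theorem tendsto_integral_selfNormalized (hf : ∀ x, f (star x * x) = 0 → x = 0) (hf1 : f 1 = 1)
    (hfree : IsFreeFamily f.toLinearMap S)
    (hstar : ∀ i, ∀ x ∈ S i, star x ∈ S i) {y : ℕ → ι → A} {τ : ℕ → ι → ℝ}
    (hy : ∀ n i, y n i ∈ S i) (hsa : ∀ n i, IsSelfAdjoint (y n i)) (hy0 : ∀ n i, f (y n i) = 0)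
    (hτ : ∀ n i, f (y n i ^ 2) = ((τ n i ^ 2 : ℝ) : ℂ)) (s : ℕ → Finset ι)
    (hτ1 : ∀ᶠ n in atTop, ∑ i ∈ s n, τ n i ^ 2 = 1)
    (hL : Tendsto (fun n => ∑ i ∈ s n, ‖y n i‖ ^ 4) atTop (𝓝 0)) {w : ℕ → A} {μ : ℕ → Measure ℝ}
    (hw : ∀ᶠ n in atTop, 0 ≤ w n ∧ w n ^ 4 * ∑ i ∈ s n, y n i ^ 2 = 1 ∧
      IsDistribution f.toLinearMap (w n * (∑ i ∈ s n, y n i) * w n) (μ n))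
    {g : ℝ → ℝ} (hg : Continuous g) :
    Tendsto (fun n => ∫ t, g t ∂μ n) atTop (𝓝 (∫ t, g t ∂semicircleLaw)) := by
  have : Nontrivial A := ⟨1, 0, fun h => by simp [h] at hf1⟩
  set x : ℕ → A := fun n => ∑ i ∈ s n, y n i with hx
  set u : ℕ → A := fun n => w n * x n * w n with hu
  have hxsa : ∀ n, IsSelfAdjoint (x n) := fun n => isSelfAdjoint_sum _ fun i _ => hsa n i
  have hsqrt : Tendsto (fun n => √(∑ i ∈ s n, ‖y n i‖ ^ 4)) atTop (𝓝 0) := by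
    simpa using hL.sqrt
  have hL1 : ∀ᶠ n in atTop, ∑ i ∈ s n, ‖y n i‖ ^ 4 ≤ 1 :=
    (hL.eventually_lt_const one_pos).mono fun n hn => hn.le
  have hx3 : ∀ᶠ n in atTop, ‖x n‖ ≤ 3 := by
    filter_upwards [hτ1, hL1] with n h1 h2
    have h := norm_sum_le_of_free hf hf1 hfree hstar (hy n) (hsa n) (hy0 n) (hτ n) (s n)
      zero_le_one (norm_le_one_of_sum_pow_four_le h2)
    rw [h1, Real.sqrt_one] at h
    linarith
  have hmom : ∀ p : Polynomial ℝ, Tendsto (fun n => f (Polynomial.aeval (x n) p)) atTop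
      (𝓝 ((∫ t, p.eval t ∂semicircleLaw : ℝ) : ℂ)) := by
    refine tendsto_integral_polynomial_of_chebyshev (L := fun n =>
      (f.toLinearMap.restrictScalars ℝ).comp (Polynomial.aeval (x n)).toLinearMap)
      (.of_forall fun n => ?_) fun k => ?_
    · simpa using hf1
    · refine squeeze_zero_norm' (a := fun n => 4 ^ (k + 1) * √(∑ i ∈ s n, ‖y n i‖ ^ 4)) ?_ ?_
      · filter_upwards [hτ1, hL1] with n h1 h2
        exact norm_state_chebyshev_le hf1 hfree hstar (hy n) (hsa n) (hy0 n) (hτ n) (s n) h1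
          (norm_le_one_of_sum_pow_four_le h2) k
      · simpa using hsqrt.const_mul (4 ^ (k + 1))
  have hw1 : Tendsto (fun n => ‖w n - 1‖) atTop (𝓝 0) := by
    refine squeeze_zero' (g := fun n => 12 * √(∑ i ∈ s n, ‖y n i‖ ^ 4))
      (.of_forall fun n => norm_nonneg _) ?_ (by simpa using hsqrt.const_mul 12)
    filter_upwards [hw, hτ1, hsqrt.eventually_lt_const (show (0 : ℝ) < 1 / 12 by norm_num)]
      with n h1 h2 h3
    have h4 := norm_sum_sq_sub_one_le_of_free hf hf1 hfree hstar (hy n) (hsa n) (hτ n) (s n) h2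
    have h5 := norm_inverse_fourth_root_sub_one_le h1.1 h1.2.1 (by linarith)
    linarith
  have hux : ∀ᶠ n in atTop, ‖u n - x n‖ ≤ 9 * ‖w n - 1‖ := by
    filter_upwards [hx3, hw1.eventually_lt_const one_pos] with n h1 h2
    exact norm_conj_sub_le h1 h2.le
  have hux0 : Tendsto (fun n => u n - x n) atTop (𝓝 0) :=
    squeeze_zero_norm' hux (by simpa using hw1.const_mul 9)
  have hu12 : ∀ᶠ n in atTop, ‖u n‖ ≤ 12 := by
    filter_upwards [hx3, hux, hw1.eventually_lt_const one_pos] with n h1 h2 h3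
    have := norm_add_le (u n - x n) (x n)
    rw [sub_add_cancel] at this
    linarith
  have hmomu : ∀ p : Polynomial ℝ, Tendsto (fun n => f (Polynomial.aeval (u n) p)) atTop
      (𝓝 ((∫ t, p.eval t ∂semicircleLaw : ℝ) : ℂ)) := fun p => by
    have h1 := tendsto_aeval_sub_aeval (by norm_num : (1 : ℝ) ≤ 12) hu12
      (hx3.mono fun n hn => hn.trans (by norm_num)) hux0 p
    have h2 : Tendsto (fun n => f (Polynomial.aeval (u n) p - Polynomial.aeval (x n) p)) atTop
        (𝓝 0) := squeeze_zero_norm (fun n => norm_state_apply_le hf1 _) (by simpa using h1.norm)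
    simpa [map_sub] using h2.add (hmom p)
  have hu0 : ∀ᶠ n in atTop, u n ≠ 0 := by
    have h1 := hmomu (Polynomial.Chebyshev.S ℝ ((2 : ℕ) : ℤ))
    rw [integral_chebyshev_semicircleLaw, if_neg two_ne_zero] at h1
    have h2 := h1.norm
    rw [Complex.ofReal_zero, norm_zero] at h2
    filter_upwards [h2.eventually_lt_const one_pos] with n hn h0
    simp [h0, hf1, Polynomial.Chebyshev.S_two] at hn
  have hae : ∀ᶠ n in atTop, IsDistribution f.toLinearMap (u n) (μ n) ∧
      ∀ᵐ t ∂μ n, |t| < 13 := by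
    filter_upwards [hw, hu12, hu0] with n h1 h2 h3
    refine ⟨h1.2.2, h1.2.2.ae_abs_lt hf hf1 ?_ h3 (by linarith)⟩
    have := (hxsa n).conjugate (w n)
    rwa [(IsSelfAdjoint.of_nonneg h1.1).star_eq] at this
  refine tendsto_integral_of_polynomial (R := 13)
    (ae_semicircleLaw_mem_Icc.mono fun t ht => ⟨by linarith [ht.1], by linarith [ht.2]⟩)
    (hae.mono fun n hn => ⟨hn.1.1, hn.2.mono fun t ht => abs_le.1 ht.le⟩) (fun p => ?_) hg
  have h := (hmomu p).congr' (hae.mono fun n hn => hn.1.map_aeval hn.2 p)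
  simpa [Function.comp_def] using (Complex.continuous_re.tendsto _).comp h

end FreeSums

section SelfNormalized
open scoped ComplexOrder

theorem star_mem_adjoin_singleton {A : Type*} [CStarAlgebra A] {a : A} (ha : IsSelfAdjoint a)
    {x : A} (hx : x ∈ Algebra.adjoin ℂ {a}) : star x ∈ Algebra.adjoin ℂ {a} := by
  rw [← Subalgebra.mem_star_iff, Subalgebra.star_adjoin_comm, Set.star_singleton, ha.star_eq]
  exact hx

variable {A : Type*} [CStarAlgebra A] [PartialOrder A] [StarOrderedRing A] {f : A →ₚ[ℂ] ℂ}

theorem selfNormalized_of_areFree (hf : ∀ x, f (star x * x) = 0 → x = 0) (hf1 : f 1 = 1)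
    {X : ℕ → A} {σ : ℕ → ℝ}
    (hsa : ∀ i, IsSelfAdjoint (X i)) (hfree : AreFree f.toLinearMap X)
    (hmean : ∀ i, f (X i) = 0) (hvar : ∀ i, f (X i ^ 2) = ((σ i ^ 2 : ℝ) : ℂ))
    (hB : ∀ n : ℕ, 0 < n → 0 < ∑ i ∈ Finset.range n, σ i ^ 2)
    (hL4 : Tendsto (fun n => Lsn X σ 4 n) atTop (𝓝 0)) :
    (∀ᶠ n in atTop, IsStrictlyPositive (∑ i ∈ Finset.range n, X i ^ 2)) ∧
      ∀ (W : ℕ → A) (μ : ℕ → Measure ℝ),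
        (∀ᶠ n in atTop, 0 ≤ W n ∧ W n ^ 4 * (∑ i ∈ Finset.range n, X i ^ 2) = 1 ∧
          IsDistribution f.toLinearMap (W n * (∑ i ∈ Finset.range n, X i) * W n) (μ n)) →
        ∀ g : ℝ → ℝ, Continuous g →
          Tendsto (fun n => ∫ t, g t ∂μ n) atTop (𝓝 (∫ t, g t ∂semicircleLaw)) := by
  set B : ℕ → ℝ := fun n => √(∑ i ∈ Finset.range n, σ i ^ 2) with hBdef
  have hBpos : ∀ᶠ n in atTop, 0 < B n :=
    (eventually_gt_atTop 0).mono fun n hn => Real.sqrt_pos.2 (hB n hn)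
  set y : ℕ → ℕ → A := fun n i => (((B n)⁻¹ : ℝ) : ℂ) • X i with hy
  have hyS : ∀ n i, y n i ∈ Algebra.adjoin ℂ {X i} := fun n i =>
    Subalgebra.smul_mem _ (Algebra.self_mem_adjoin_singleton ℂ _) _
  have hysa : ∀ n i, IsSelfAdjoint (y n i) := fun n i => by
    simp only [hy, Complex.coe_smul]
    exact (IsSelfAdjoint.all _).smul (hsa i)
  have hstar : ∀ i, ∀ x ∈ Algebra.adjoin ℂ {X i}, star x ∈ Algebra.adjoin ℂ {X i} :=
    fun i x hx => star_mem_adjoin_singleton (hsa i) hx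
  have hy0 : ∀ n i, f (y n i) = 0 := fun n i => by
    simp only [hy, map_smul, hmean, smul_zero]
  have hyτ : ∀ n i, f (y n i ^ 2) = ((((B n)⁻¹ * σ i) ^ 2 : ℝ) : ℂ) := fun n i => by
    simp only [hy, smul_pow, map_smul, hvar, smul_eq_mul]
    push_cast
    ring
  have hτ1 : ∀ᶠ n in atTop, ∑ i ∈ Finset.range n, ((B n)⁻¹ * σ i) ^ 2 = 1 := by
    filter_upwards [hBpos] with n hn
    simp only [mul_pow]
    rw [← Finset.mul_sum, ← Real.sq_sqrt (Finset.sum_nonneg fun i _ => sq_nonneg (σ i)),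
      ← mul_pow, inv_mul_cancel₀ hn.ne', one_pow]
  have hL : Tendsto (fun n => ∑ i ∈ Finset.range n, ‖y n i‖ ^ 4) atTop (𝓝 0) := by
    refine hL4.congr fun n => ?_
    simp only [hy, norm_smul, Complex.norm_real, mul_pow, ← Finset.mul_sum]
    rw [Real.norm_of_nonneg (by positivity), Lsn, inv_pow, div_eq_inv_mul]
  have hsq : ∀ n, ∑ i ∈ Finset.range n, y n i ^ 2 =
      (((B n)⁻¹ ^ 2 : ℝ) : ℂ) • ∑ i ∈ Finset.range n, X i ^ 2 := fun n => by
    simp only [hy, smul_pow, ← Finset.smul_sum, Complex.ofReal_pow]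
  constructor
  · have hsqrt : Tendsto (fun n => √(∑ i ∈ Finset.range n, ‖y n i‖ ^ 4)) atTop (𝓝 0) := by
      simpa using hL.sqrt
    filter_upwards [hτ1, hBpos, hsqrt.eventually_lt_const (show (0 : ℝ) < 1 / 6 by norm_num)]
      with n h1 h2 h3
    have h4 := norm_sum_sq_sub_one_le_of_free hf hf1 hfree hstar (hyS n) (hysa n) (hyτ n)
      (Finset.range n) h1
    have h5 : IsUnit (∑ i ∈ Finset.range n, y n i ^ 2) :=
      isUnit_of_norm_sub_one_lt (by linarith)
    have h6 : (((B n)⁻¹ ^ 2 : ℝ) : ℂ) ≠ 0 := Complex.ofReal_ne_zero.2 (by positivity)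
    rw [hsq] at h5
    exact ((isUnit_smul_iff (Units.mk0 _ h6) _).1 h5).isStrictlyPositive
      (Finset.sum_nonneg fun i _ => (hsa i).sq_nonneg)
  · intro W μ hW g hg
    refine tendsto_integral_selfNormalized hf hf1 hfree hstar hyS hysa hy0 hyτ Finset.range hτ1 hL
      (w := fun n => ((√(B n) : ℝ) : ℂ) • W n) ?_ hg
    filter_upwards [hW, hBpos] with n h1 h2
    have h3 : √(B n) ^ 2 = B n := Real.sq_sqrt h2.le
    refine ⟨?_, ?_, ?_⟩
    · rw [Complex.coe_smul]
      exact smul_nonneg (Real.sqrt_nonneg _) h1.1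
    · rw [hsq, smul_pow, smul_mul_smul_comm, h1.2.1, ← Complex.ofReal_pow, ← Complex.ofReal_mul,
        show √(B n) ^ 4 = (√(B n) ^ 2) ^ 2 by ring, h3, ← mul_pow, mul_inv_cancel₀ h2.ne']
      simp
    · have h4 : ∑ i ∈ Finset.range n, y n i =
          (((B n)⁻¹ : ℝ) : ℂ) • ∑ i ∈ Finset.range n, X i := Finset.smul_sum.symm
      have h5 : √(B n) * (B n)⁻¹ * √(B n) = 1 := by
        rw [mul_right_comm, ← sq, h3, mul_inv_cancel₀ h2.ne']
      rw [h4, smul_mul_smul_comm, smul_mul_smul_comm, ← Complex.ofReal_mul, ← Complex.ofReal_mul,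
        h5, Complex.ofReal_one, one_smul]
      exact h1.2.2

end SelfNormalized

/-- If `L_{S,4n} → 0` then for all sufficiently large `n` the self-normalized sum
`U_n = V_n^{-1/2} S_n V_n^{-1/2}` (written `W n * S_n * W n` with `W n ≥ 0` the inverse fourth
root of `V_n²`) is well-defined, its analytic distribution `μ n` converges weakly to the
semicircle law, and all moments converge to those of the semicircle law. -/
theorem stmt_1 (A : Type*) [NormedRing A] [StarRing A] [CStarRing A] [NormedAlgebra ℂ A]
    [CompleteSpace A] [StarModule ℂ A] [PartialOrder A] [StarOrderedRing A]
    (φ : A →ₗ[ℂ] ℂ) (hφ : IsState φ) (hTr : IsTracial φ) (hFa : IsFaithful φ)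
    (X : ℕ → A) (σ : ℕ → ℝ)
    (hsa : ∀ i, IsSelfAdjoint (X i)) (hfree : AreFree φ X)
    (hmean : ∀ i, φ (X i) = 0) (hvar : ∀ i, φ (X i ^ 2) = ((σ i ^ 2 : ℝ) : ℂ))
    (hB : ∀ n : ℕ, 0 < n → 0 < ∑ i ∈ Finset.range n, σ i ^ 2)
    (hL4 : Tendsto (fun n => Lsn X σ 4 n) atTop (nhds 0)) :
    ∃ n0 : ℕ,
      (∀ n, n0 ≤ n →
        IsUnit (∑ i ∈ Finset.range n, X i ^ 2) ∧
        ∃ W : A, 0 ≤ W ∧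
          W ^ 4 * (∑ i ∈ Finset.range n, X i ^ 2) = 1 ∧
          (∑ i ∈ Finset.range n, X i ^ 2) * W ^ 4 = 1) ∧
      ∀ (W : ℕ → A) (μ : ℕ → Measure ℝ),
        (∀ n, n0 ≤ n →
          0 ≤ W n ∧
          (W n) ^ 4 * (∑ i ∈ Finset.range n, X i ^ 2) = 1 ∧
          (∑ i ∈ Finset.range n, X i ^ 2) * (W n) ^ 4 = 1 ∧
          IsDistribution φ (W n * (∑ i ∈ Finset.range n, X i) * W n) (μ n)) →
        (∀ f : BoundedContinuousFunction ℝ ℝ,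
          Tendsto (fun n => ∫ x, f x ∂(μ n)) atTop
            (nhds (∫ x, f x ∂semicircleLaw))) ∧
        ∀ k : ℕ,
          Tendsto (fun n => ∫ x, x ^ k ∂(μ n)) atTop
            (nhds (∫ x, x ^ k ∂semicircleLaw)) := by
  let _ : CStarAlgebra A := { }
  open scoped ComplexOrder in
  obtain ⟨f, rfl⟩ : ∃ f : A →ₚ[ℂ] ℂ, f.toLinearMap = φ :=
    ⟨.mk₀ φ fun x hx => by
      obtain ⟨y, rfl⟩ := CStarAlgebra.nonneg_iff_eq_star_mul_self.1 hx
      exact Complex.le_def.2 ⟨(hφ.2 y).1, (hφ.2 y).2.symm⟩, rfl⟩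
  obtain ⟨hpos, hconv⟩ := selfNormalized_of_areFree hFa hφ.1 hsa hfree hmean hvar hB hL4
  obtain ⟨n0, hn0⟩ := eventually_atTop.1 hpos
  refine ⟨n0, fun n hn => ⟨(hn0 n hn).isUnit, exists_inverse_fourth_root (hn0 n hn)⟩,
    fun W μ h => ?_⟩
  have hlim := hconv W μ (eventually_atTop.2 ⟨n0, fun n hn =>
    ⟨(h n hn).1, (h n hn).2.1, (h n hn).2.2.2⟩⟩)
  exact ⟨fun g => hlim g g.continuous, fun k => hlim _ (continuous_pow k)⟩
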